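/- arXiv:2506.11373 — 4 statements merged into one kernel-verified Lean document; each statement's English description precedes it below -/
import Mathlib

section
/- There exists γ* > 0 such that the following holds: if Γ ≻ γ*I (in the Loewner order), there is ε ∈ (0,1) with ‖K* − K̄‖_F ≤ (ε/2)·√(λ_min(Γ)) / (√(λ_min(Γ))·‖S B_a‖_F + ‖S B_u‖_F), L > 0 is a Lipschitz constant of ∇J̃ on S₀, and 0 < ω < (2/L)·λ_min(Γ⁻¹)/λ_max(Γ⁻¹)², then the sequence of iterates (Λ^i) converges to a global minimizer of J̃ over S₀, i.e., to a point Λ̂ ∈ S₀ with J̃(Λ̂) ≤ J̃(Λ) for all Λ ∈ S₀. -/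
open Matrix Filter Topology

noncomputable section

/-- A real square matrix is Hurwitz if every complex eigenvalue has strictly
negative real part. -/
def IsHurwitz {N : ℕ} (M : Matrix (Fin N) (Fin N) ℝ) : Prop :=
  ∀ μ : ℂ, μ ∈ spectrum ℂ (M.map (algebraMap ℝ ℂ)) → μ.re < 0

/-- Frobenius norm of a real matrix. -/
def frobNorm {p q : ℕ} (M : Matrix (Fin p) (Fin q) ℝ) : ℝ :=
  Real.sqrt (Matrix.trace (Mᵀ * M))

/-- Minimal eigenvalue of a (Hermitian) real matrix. -/
def eigMin {m : ℕ} (M : Matrix (Fin m) (Fin m) ℝ) : ℝ :=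
  if hM : M.IsHermitian then ⨅ i, hM.eigenvalues i else 0

/-- Maximal eigenvalue of a (Hermitian) real matrix. -/
def eigMax {m : ℕ} (M : Matrix (Fin m) (Fin m) ℝ) : ℝ :=
  if hM : M.IsHermitian then ⨆ i, hM.eigenvalues i else 0

variable {n m_u m_a : ℕ}

/-- `P` is the stabilizing solution of the spoofed ARE for the gain `Λ`. -/
def IsStabSol (A : Matrix (Fin n) (Fin n) ℝ) (Bu : Matrix (Fin n) (Fin m_u) ℝ)
    (Ba : Matrix (Fin n) (Fin m_a) ℝ) (Q : Matrix (Fin n) (Fin n) ℝ)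
    (R : Matrix (Fin m_a) (Fin m_a) ℝ)
    (Λ : Matrix (Fin m_u) (Fin n) ℝ) (P : Matrix (Fin n) (Fin n) ℝ) : Prop :=
  P.PosDef ∧
  (A + Bu * Λ)ᵀ * P + P * (A + Bu * Λ) + Q + P * Ba * R⁻¹ * Baᵀ * P = 0 ∧
  IsHurwitz (A + Bu * Λ + Ba * R⁻¹ * Baᵀ * P)

/-- `Pim` is a symmetric solution of the Lyapunov equation defining `Π(Λ)`,
given the stabilizing ARE solution `P = P_u(Λ)`. -/
def IsLyapSol (A : Matrix (Fin n) (Fin n) ℝ) (Bu : Matrix (Fin n) (Fin m_u) ℝ)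
    (Ba : Matrix (Fin n) (Fin m_a) ℝ) (R : Matrix (Fin m_a) (Fin m_a) ℝ)
    (Kbar : Matrix (Fin m_a) (Fin n) ℝ)
    (Λ : Matrix (Fin m_u) (Fin n) ℝ) (P Pim : Matrix (Fin n) (Fin n) ℝ) : Prop :=
  Pim.IsHermitian ∧
  (A + Bu * Λ + Ba * R⁻¹ * Baᵀ * P) * Pim + Pim * (A + Bu * Λ + Ba * R⁻¹ * Baᵀ * P)ᵀ
    - Kbarᵀ * R⁻¹ * Baᵀ - Ba * R⁻¹ * Kbar
    + P * Ba * (R⁻¹ * R⁻¹) * Baᵀ + Ba * (R⁻¹ * R⁻¹) * Baᵀ * P = 0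

/-- The deception cost `J̃(Λ)`, expressed through a choice function `Pu` for the
stabilizing solution of the spoofed ARE. -/
def Jcost (Ba : Matrix (Fin n) (Fin m_a) ℝ) (R : Matrix (Fin m_a) (Fin m_a) ℝ)
    (Γ : Matrix (Fin m_u) (Fin m_u) ℝ) (Kbar : Matrix (Fin m_a) (Fin n) ℝ)
    (Pu : Matrix (Fin m_u) (Fin n) ℝ → Matrix (Fin n) (Fin n) ℝ)
    (Λ : Matrix (Fin m_u) (Fin n) ℝ) : ℝ :=
  frobNorm (R⁻¹ * Baᵀ * Pu Λ - Kbar) ^ 2 + Matrix.trace (Λᵀ * Γ * Λ)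

/-- The sublevel set `S₀`. -/
def S0 (A : Matrix (Fin n) (Fin n) ℝ) (Bu : Matrix (Fin n) (Fin m_u) ℝ)
    (Ba : Matrix (Fin n) (Fin m_a) ℝ) (Q : Matrix (Fin n) (Fin n) ℝ)
    (R : Matrix (Fin m_a) (Fin m_a) ℝ) (Γ : Matrix (Fin m_u) (Fin m_u) ℝ)
    (Kbar : Matrix (Fin m_a) (Fin n) ℝ)
    (Pu : Matrix (Fin m_u) (Fin n) ℝ → Matrix (Fin n) (Fin n) ℝ) :
    Set (Matrix (Fin m_u) (Fin n) ℝ) :=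
  {Λ | (∃ P, IsStabSol A Bu Ba Q R Λ P) ∧
    Jcost Ba R Γ Kbar Pu Λ ≤ Jcost Ba R Γ Kbar Pu 0}

theorem SemiconjBy.aeval_right' {R B : Type*} [CommSemiring R] [Semiring B] [Algebra R B]
    {a x y : B} (h : SemiconjBy a x y) (p : Polynomial R) :
    SemiconjBy a (Polynomial.aeval x p) (Polynomial.aeval y p) := by
  induction p using Polynomial.induction_on' with
  | add p q hp hq => simpa using hp.add_right hq
  | monomial k r =>
    simp only [Polynomial.aeval_monomial]
    have hr : SemiconjBy a (algebraMap R B r) (algebraMap R B r) := (Algebra.commutes r a).symm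
    exact hr.mul_right (h.pow_right k)

theorem eq_zero_of_mul_add_mul_eq_zero {m : ℕ} {M N X : Matrix (Fin m) (Fin m) ℂ}
    (hM : ∀ μ ∈ spectrum ℂ M, μ.re < 0) (hN : ∀ μ ∈ spectrum ℂ N, μ.re < 0)
    (h : M * X + X * N = 0) : X = 0 := by
  rcases isEmpty_or_nonempty (Fin m) with hm | hm
  · exact Subsingleton.elim _ _
  have hs : SemiconjBy X N (-M) := by
    rw [SemiconjBy, neg_mul]; exact eq_neg_of_add_eq_zero_right h
  have key := hs.aeval_right' N.charpoly
  rw [SemiconjBy, Matrix.aeval_self_charpoly, mul_zero] at key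
  have hu : IsUnit (Polynomial.aeval (-M) N.charpoly) := by
    by_contra hu
    rw [← spectrum.zero_mem_iff ℂ, spectrum.map_polynomial_aeval_of_nonempty _ _
      (spectrum.nonempty_of_isAlgClosed_of_finiteDimensional ℂ _)] at hu
    obtain ⟨μ, hμ, hr⟩ := hu
    have h1 := hN μ (Matrix.mem_spectrum_of_isRoot_charpoly hr)
    rw [← spectrum.neg_eq] at hμ
    have h2 := hM _ (Set.mem_neg.1 hμ)
    simp at h2
    linarith
  exact (hu.mul_right_eq_zero).1 key.symm

theorem IsHurwitz.transpose {m : ℕ} {M : Matrix (Fin m) (Fin m) ℝ} (hM : IsHurwitz M) :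
    IsHurwitz Mᵀ := by
  intro μ hμ
  refine hM μ ?_
  rw [Matrix.mem_spectrum_iff_isRoot_charpoly] at hμ ⊢
  rwa [Matrix.transpose_map, Matrix.charpoly_transpose] at hμ

/-- The Sylvester operator of a pair of Hurwitz matrices is injective. -/
theorem IsHurwitz.eq_zero_of_mul_add_mul_eq_zero {m : ℕ} {M N X : Matrix (Fin m) (Fin m) ℝ}
    (hM : IsHurwitz M) (hN : IsHurwitz N) (h : M * X + X * N = 0) : X = 0 := by
  have h' := congrArg (fun Y => Y.map (algebraMap ℝ ℂ)) h
  simp only [Matrix.map_add _ (map_add _), Matrix.map_mul, Matrix.map_zero _ (map_zero _)] at h'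
  have := _root_.eq_zero_of_mul_add_mul_eq_zero hM hN h'
  exact Matrix.map_injective (algebraMap ℝ ℂ).injective
    (this.trans (Matrix.map_zero _ (map_zero _)).symm)

theorem isHurwitz_of_posDef {m : ℕ} {N S : Matrix (Fin m) (Fin m) ℝ} (hS : S.PosDef)
    (hN : (-(Nᵀ * S + S * N)).PosDef) : IsHurwitz N := by
  intro μ hμ
  obtain ⟨v, hv0, hv⟩ : ∃ v : Fin m → ℂ, v ≠ 0 ∧ (N.map (algebraMap ℝ ℂ)) *ᵥ v = μ • v := by
    rw [Matrix.mem_spectrum_iff_isRoot_charpoly, Polynomial.IsRoot, Matrix.eval_charpoly] at hμ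
    obtain ⟨v, hv0, hv⟩ := Matrix.exists_mulVec_eq_zero_iff.2 hμ
    refine ⟨v, hv0, ?_⟩
    rw [Matrix.sub_mulVec, sub_eq_zero] at hv
    rw [← hv]; simp [← Matrix.smul_one_eq_diagonal, Matrix.smul_mulVec]
  set a : Fin m → ℝ := fun i => (v i).re with ha
  set b : Fin m → ℝ := fun i => (v i).im with hb
  have h1 : N *ᵥ a = μ.re • a - μ.im • b := by
    ext i
    have := congrArg Complex.re (congrFun hv i)
    simpa [Matrix.mulVec, dotProduct] using this
  have h2 : N *ᵥ b = μ.re • b + μ.im • a := by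
    ext i
    have := congrArg Complex.im (congrFun hv i)
    simpa [Matrix.mulVec, dotProduct] using this
  have hsym : ∀ x y : Fin m → ℝ, x ⬝ᵥ (S *ᵥ y) = y ⬝ᵥ (S *ᵥ x) := by
    intro x y
    have hT : Sᵀ = S := by simpa using hS.1.eq
    rw [Matrix.dotProduct_mulVec, ← Matrix.mulVec_transpose, hT, dotProduct_comm]
  have hq : ∀ x : Fin m → ℝ, x ⬝ᵥ ((-(Nᵀ * S + S * N)) *ᵥ x) = -(2 * (x ⬝ᵥ (S *ᵥ (N *ᵥ x)))) := by
    intro x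
    have : x ⬝ᵥ ((Nᵀ * S) *ᵥ x) = x ⬝ᵥ (S *ᵥ (N *ᵥ x)) := by
      rw [← Matrix.mulVec_mulVec, Matrix.dotProduct_mulVec, Matrix.vecMul_transpose, hsym]
    rw [Matrix.neg_mulVec, Matrix.add_mulVec, dotProduct_neg, dotProduct_add, this,
      ← Matrix.mulVec_mulVec]
    ring
  have hab : a ≠ 0 ∨ b ≠ 0 := by
    by_contra! hcon
    apply hv0
    ext i
    exact Complex.ext (congrFun hcon.1 i) (congrFun hcon.2 i)
  have e1 := hq a
  have e2 := hq b
  rw [h1] at e1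
  rw [h2] at e2
  simp only [Matrix.mulVec_sub, Matrix.mulVec_add, Matrix.mulVec_smul, dotProduct_sub,
    dotProduct_add, dotProduct_smul, smul_eq_mul] at e1 e2
  rw [hsym b a] at e2
  have ps := hS.posSemidef.dotProduct_mulVec_nonneg
  have pn := hN.posSemidef.dotProduct_mulVec_nonneg
  have ps' := fun {x} => hS.dotProduct_mulVec_pos (x := x)
  have pn' := fun {x} => hN.dotProduct_mulVec_pos (x := x)
  simp only [star_trivial] at ps pn ps' pn'
  have sa := ps a
  have sb := ps b
  have na := pn a
  have nb := pn b
  have hsum : 0 < a ⬝ᵥ ((-(Nᵀ * S + S * N)) *ᵥ a) + b ⬝ᵥ ((-(Nᵀ * S + S * N)) *ᵥ b) := by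
    rcases hab with h | h
    · linarith [pn' h]
    · linarith [pn' h]
  rw [e1, e2] at hsum
  by_contra! hμ0
  nlinarith [mul_nonneg hμ0 sa, mul_nonneg hμ0 sb]

section Frobenius

open scoped Matrix.Norms.Frobenius

theorem frobNorm_eq_norm {p q : ℕ} (M : Matrix (Fin p) (Fin q) ℝ) : frobNorm M = ‖M‖ := by
  rw [frobNorm, Matrix.frobenius_norm_def, Real.sqrt_eq_rpow, Finset.sum_comm]
  congr 1
  simp [Matrix.trace, Matrix.mul_apply, pow_two]

theorem trace_transpose_mul_self {p q : ℕ} (M : Matrix (Fin p) (Fin q) ℝ) :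
    (Mᵀ * M).trace = ‖M‖ ^ 2 := by
  rw [← frobNorm_eq_norm, frobNorm, Real.sq_sqrt]
  have := (Matrix.posSemidef_conjTranspose_mul_self M).trace_nonneg
  rwa [Matrix.conjTranspose_eq_transpose_of_trivial] at this

theorem abs_trace_transpose_mul_le {p q : ℕ} (M N : Matrix (Fin p) (Fin q) ℝ) :
    |(Mᵀ * N).trace| ≤ ‖M‖ * ‖N‖ := by
  refine abs_le_of_sq_le_sq ?_ (by positivity)
  rw [mul_pow, ← trace_transpose_mul_self, ← trace_transpose_mul_self]
  simp only [Matrix.trace, Matrix.diag, Matrix.mul_apply, Matrix.transpose_apply,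
    ← Finset.sum_product']
  simpa only [pow_two] using Finset.sum_mul_sq_le_sq_mul_sq (Finset.univ ×ˢ Finset.univ)
    (fun x : Fin q × Fin p => M x.2 x.1) (fun x => N x.2 x.1)

theorem abs_trace_mul_le {p q : ℕ} (M : Matrix (Fin p) (Fin q) ℝ)
    (N : Matrix (Fin q) (Fin p) ℝ) : |(M * N).trace| ≤ ‖M‖ * ‖N‖ := by
  simpa [Matrix.frobenius_norm_transpose] using abs_trace_transpose_mul_le Mᵀ N

theorem Matrix.PosDef.exists_posSemidef_sub {m : ℕ} {P : Matrix (Fin m) (Fin m) ℝ}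
    (hP : P.PosDef) : ∃ c : ℝ, 0 < c ∧ (P - c • (1 : Matrix (Fin m) (Fin m) ℝ)).PosSemidef := by
  rcases isEmpty_or_nonempty (Fin m) with hm | hm
  · exact ⟨1, one_pos, by rw [Subsingleton.elim (P - _) 0]; exact .zero⟩
  obtain ⟨i, hi⟩ := Finite.exists_min hP.1.eigenvalues
  refine ⟨_, hP.eigenvalues_pos i, ?_⟩
  rw [Matrix.posSemidef_iff_isHermitian_and_spectrum_nonneg]
  refine ⟨hP.1.sub (by simp [Matrix.IsHermitian]), ?_⟩
  rw [← Algebra.algebraMap_eq_smul_one, ← spectrum.sub_singleton_eq,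
    hP.1.spectrum_real_eq_range_eigenvalues]
  rintro _ ⟨_, ⟨j, rfl⟩, _, rfl, rfl⟩
  exact sub_nonneg.2 (hi j)

theorem Matrix.PosDef.eventually_posDef {m : ℕ} {P : Matrix (Fin m) (Fin m) ℝ}
    (hP : P.PosDef) : ∀ᶠ M in 𝓝 P, M.IsHermitian → M.PosDef := by
  obtain ⟨c, hc, hPc⟩ := hP.exists_posSemidef_sub
  filter_upwards [Metric.ball_mem_nhds P hc] with M hM hMh
  rw [mem_ball_iff_norm] at hM
  refine .of_dotProduct_mulVec_pos hMh fun {x} hx => ?_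
  have h1 := hPc.dotProduct_mulVec_nonneg x
  have hxx : 0 < x ⬝ᵥ x := by simpa using Matrix.dotProduct_star_self_pos_iff.2 hx
  simp only [star_trivial, Matrix.sub_mulVec, Matrix.smul_mulVec, Matrix.one_mulVec,
    dotProduct_sub, dotProduct_smul, smul_eq_mul] at h1 ⊢
  have h2 : |x ⬝ᵥ ((M - P) *ᵥ x)| ≤ ‖M - P‖ * (x ⬝ᵥ x) := by
    have h3 := abs_trace_mul_le (M - P) (Matrix.vecMulVec x x)
    have h4 : ((M - P) * Matrix.vecMulVec x x).trace = x ⬝ᵥ ((M - P) *ᵥ x) := by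
      rw [Matrix.mul_vecMulVec, Matrix.trace_vecMulVec, dotProduct_comm]
    have h5 : ‖Matrix.vecMulVec x x‖ = x ⬝ᵥ x := by
      rw [← abs_of_pos hxx, ← abs_norm, ← sq_eq_sq_iff_abs_eq_abs, ← trace_transpose_mul_self,
        Matrix.transpose_vecMulVec, Matrix.vecMulVec_mul_vecMulVec]
      simp [pow_two]
    rwa [h4, h5] at h3
  rw [Matrix.sub_mulVec, dotProduct_sub] at h2
  have := (abs_le.1 h2).1
  nlinarith

theorem eigMin_le_eigMax {m : ℕ} (M : Matrix (Fin m) (Fin m) ℝ) : eigMin M ≤ eigMax M := by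
  unfold eigMin eigMax
  split_ifs with h
  · rcases isEmpty_or_nonempty (Fin m) with hm | hm
    · simp
    · obtain ⟨i⟩ := hm
      exact (ciInf_le (Set.finite_range h.eigenvalues).bddBelow i).trans
        (le_ciSup (Set.finite_range h.eigenvalues).bddAbove i)
  · exact le_rfl

theorem posSemidef_eigMax_sub {m : ℕ} {T : Matrix (Fin m) (Fin m) ℝ} (hT : T.IsHermitian) :
    (eigMax T • (1 : Matrix (Fin m) (Fin m) ℝ) - T).PosSemidef := by
  rw [Matrix.posSemidef_iff_isHermitian_and_spectrum_nonneg]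
  refine ⟨.sub (by simp [Matrix.IsHermitian]) hT, ?_⟩
  rw [← Algebra.algebraMap_eq_smul_one, ← spectrum.singleton_sub_eq,
    hT.spectrum_real_eq_range_eigenvalues]
  rintro _ ⟨_, rfl, _, ⟨j, rfl⟩, rfl⟩
  rw [eigMax, dif_pos hT]
  exact sub_nonneg.2 (le_ciSup (Set.finite_range hT.eigenvalues).bddAbove j)

theorem trace_transpose_mul_nonneg {m q : ℕ} {T : Matrix (Fin m) (Fin m) ℝ}
    (hT : T.PosSemidef) (X : Matrix (Fin m) (Fin q) ℝ) : 0 ≤ (Xᵀ * T * X).trace := by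
  simpa [Matrix.conjTranspose_eq_transpose_of_trivial] using
    (hT.conjTranspose_mul_mul_same X).trace_nonneg

theorem norm_mul_le_eigMax_mul {m q : ℕ} {T : Matrix (Fin m) (Fin m) ℝ} (hT : T.PosDef)
    (X : Matrix (Fin m) (Fin q) ℝ) : ‖T * X‖ ≤ eigMax T * ‖X‖ := by
  rcases isEmpty_or_nonempty (Fin m) with hm | hm
  · rw [Subsingleton.elim (T * X) 0, Subsingleton.elim X 0]; simp
  have hM := posSemidef_eigMax_sub hT.1
  set l := eigMax T with hl
  have hl0 : 0 < l := by
    obtain ⟨i⟩ := hm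
    rw [hl, eigMax, dif_pos hT.1]
    exact (hT.eigenvalues_pos i).trans_le (le_ciSup (Set.finite_range _).bddAbove i)
  set M := l • (1 : Matrix (Fin m) (Fin m) ℝ) - T with hMdef
  have hTt : Tᵀ = T := by simpa using hT.1.eq
  have hMt : Mᵀ = M := by simpa using hM.1.eq
  have h1 := trace_transpose_mul_nonneg hM X
  have h2 := trace_transpose_mul_nonneg hT.posSemidef (M * X)
  have h3 := trace_transpose_mul_nonneg hM (T * X)
  have key : l ^ 2 * (Xᵀ * X).trace - ((T * X)ᵀ * (T * X)).trace
      = l * (Xᵀ * M * X).trace + l⁻¹ * (((M * X)ᵀ * T * (M * X)).trace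
        + ((T * X)ᵀ * M * (T * X)).trace) := by
    have e1 : (M * X)ᵀ * T * (M * X) + (T * X)ᵀ * M * (T * X) = l • (Xᵀ * (T * M) * X) := by
      rw [Matrix.transpose_mul, Matrix.transpose_mul, hTt, hMt]
      have : M * T * M + T * M * T = l • (T * M) := by
        rw [hMdef]
        simp only [Matrix.mul_sub, Matrix.sub_mul, Matrix.smul_mul, Matrix.mul_smul,
          Matrix.one_mul, Matrix.mul_one, smul_sub, Matrix.mul_assoc]
        abel
      calc _ = Xᵀ * (M * T * M + T * M * T) * X := by
            simp only [Matrix.mul_add, Matrix.add_mul, Matrix.mul_assoc]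
        _ = _ := by rw [this]; simp
    rw [← Matrix.trace_add, e1, Matrix.trace_smul, smul_eq_mul, inv_mul_cancel_left₀ hl0.ne',
      Matrix.transpose_mul, hTt, hMdef]
    simp only [Matrix.mul_sub, Matrix.sub_mul, Matrix.smul_mul, Matrix.mul_smul,
      Matrix.mul_one, Matrix.mul_assoc, Matrix.trace_sub, Matrix.trace_smul,
      smul_eq_mul]
    ring
  rw [trace_transpose_mul_self, trace_transpose_mul_self] at key
  refine le_of_sq_le_sq ?_ (by positivity)
  have : 0 ≤ l * (Xᵀ * M * X).trace + l⁻¹ * (((M * X)ᵀ * T * (M * X)).trace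
        + ((T * X)ᵀ * M * (T * X)).trace) := by positivity
  rw [mul_pow]
  linarith

theorem mul_sq_norm_le_trace {m q : ℕ} {G : Matrix (Fin m) (Fin m) ℝ} {c : ℝ}
    (hG : (G - c • (1 : Matrix (Fin m) (Fin m) ℝ)).PosDef) (X : Matrix (Fin m) (Fin q) ℝ) :
    c * ‖X‖ ^ 2 ≤ (Xᵀ * G * X).trace := by
  have h := trace_transpose_mul_nonneg hG.posSemidef X
  rw [Matrix.mul_sub, Matrix.sub_mul, Matrix.trace_sub] at h
  simp only [Matrix.mul_smul, Matrix.smul_mul, Matrix.mul_one, Matrix.trace_smul, smul_eq_mul,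
    trace_transpose_mul_self] at h
  linarith

theorem mul_norm_le_norm_mul {m q : ℕ} {G : Matrix (Fin m) (Fin m) ℝ} {c : ℝ}
    (hG : (G - c • (1 : Matrix (Fin m) (Fin m) ℝ)).PosDef) (X : Matrix (Fin m) (Fin q) ℝ) :
    c * ‖X‖ ≤ ‖G * X‖ := by
  rcases (norm_nonneg X).eq_or_lt with h0 | h0
  · rw [← h0]; simp
  have h1 := mul_sq_norm_le_trace hG X
  have h2 := (le_abs_self _).trans (abs_trace_transpose_mul_le X (G * X))
  rw [← Matrix.mul_assoc] at h2
  nlinarith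

section Derivatives

variable {E F : Type*} [NormedAddCommGroup E] [NormedSpace ℝ E] [NormedAddCommGroup F]
  [NormedSpace ℝ F]

/-- `f` has a strict derivative at `x` given by the formula `φ`. -/
def HasStrictDerivFormula (f : E → F) (φ : E → F) (x : E) : Prop :=
  ∃ D : E →L[ℝ] F, HasStrictFDerivAt f D x ∧ ∀ d, D d = φ d

theorem ContinuousLinearMap.hasStrictDerivFormula (L : E →L[ℝ] F) (x : E) :
    HasStrictDerivFormula L L x :=
  ⟨L, L.hasStrictFDerivAt, fun _ => rfl⟩

theorem hasStrictDerivFormula_const (c : F) (x : E) :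
    HasStrictDerivFormula (fun _ : E => c) (fun _ => 0) x :=
  ⟨0, hasStrictFDerivAt_const c x, fun _ => rfl⟩

namespace HasStrictDerivFormula

theorem add {f g φ ψ : E → F} {x : E} (hf : HasStrictDerivFormula f φ x)
    (hg : HasStrictDerivFormula g ψ x) :
    HasStrictDerivFormula (fun y => f y + g y) (fun d => φ d + ψ d) x := by
  obtain ⟨D, hD, hφ⟩ := hf
  obtain ⟨D', hD', hψ⟩ := hg
  exact ⟨D + D', hD.add hD', fun d => by simp [hφ, hψ]⟩

theorem prodMk {H : Type*} [NormedAddCommGroup H] [NormedSpace ℝ H] {f φ : E → F}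
    {g ψ : E → H} {x : E} (hf : HasStrictDerivFormula f φ x)
    (hg : HasStrictDerivFormula g ψ x) :
    HasStrictDerivFormula (fun y => (f y, g y)) (fun d => (φ d, ψ d)) x := by
  obtain ⟨D, hD, hφ⟩ := hf
  obtain ⟨D', hD', hψ⟩ := hg
  exact ⟨D.prod D', hD.prodMk hD', fun d => by simp [hφ, hψ]⟩

theorem matrix_mul {p q r : ℕ} {f φ : E → Matrix (Fin p) (Fin q) ℝ}
    {g ψ : E → Matrix (Fin q) (Fin r) ℝ} {x : E} (hf : HasStrictDerivFormula f φ x)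
    (hg : HasStrictDerivFormula g ψ x) :
    HasStrictDerivFormula (fun y => f y * g y) (fun d => f x * ψ d + φ d * g x) x := by
  obtain ⟨D, hD, hφ⟩ := hf
  obtain ⟨D', hD', hψ⟩ := hg
  have hb : IsBoundedBilinearMap ℝ
      (fun z : Matrix (Fin p) (Fin q) ℝ × Matrix (Fin q) (Fin r) ℝ => z.1 * z.2) :=
    ⟨fun a b c => Matrix.add_mul a b c, fun c a b => Matrix.smul_mul c a b,
      fun a b c => Matrix.mul_add a b c, fun c a b => Matrix.mul_smul a c b,
      1, one_pos, fun a b => by simpa using Matrix.frobenius_norm_mul a b⟩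
  refine ⟨_, (hb.hasStrictFDerivAt (f x, g x)).comp x (hD.prodMk hD'), fun d => ?_⟩
  simp [IsBoundedBilinearMap.deriv_apply, hφ, hψ]

theorem matrix_transpose {p q : ℕ} {f φ : E → Matrix (Fin p) (Fin q) ℝ} {x : E}
    (hf : HasStrictDerivFormula f φ x) :
    HasStrictDerivFormula (fun y => (f y)ᵀ) (fun d => (φ d)ᵀ) x := by
  obtain ⟨D, hD, hφ⟩ := hf
  let T : Matrix (Fin p) (Fin q) ℝ →L[ℝ] Matrix (Fin q) (Fin p) ℝ :=
    LinearMap.toContinuousLinearMap (Matrix.transposeLinearEquiv (Fin p) (Fin q) ℝ ℝ).toLinearMap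
  exact ⟨T.comp D, T.hasStrictFDerivAt.comp x hD, fun d => congrArg T (hφ d)⟩

/-- A Lipschitz local right inverse at a point where the derivative is injective. -/
theorem exists_local_rightInverse [FiniteDimensional ℝ E] {f φ : E → E} {x : E}
    (hf : HasStrictDerivFormula f φ x) (hφ : ∀ d, φ d = 0 → d = 0) :
    ∃ g : E → E, g (f x) = x ∧ ContinuousAt g (f x) ∧
      (∃ K, ∃ s ∈ 𝓝 (f x), LipschitzOnWith K g s) ∧ ∀ᶠ z in 𝓝 (f x), f (g z) = z := by
  obtain ⟨D, hD, hDφ⟩ := hf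
  have hinj : Function.Injective D :=
    (injective_iff_map_eq_zero D).2 fun d hd => hφ d ((hDφ d).symm.trans hd)
  let e : E ≃L[ℝ] E :=
    (LinearEquiv.ofInjectiveEndo D.toLinearMap hinj).toContinuousLinearEquiv
  have he : (e : E →L[ℝ] E) = D := by ext d; rfl
  have := FiniteDimensional.complete ℝ E
  rw [← he] at hD
  exact ⟨hD.localInverse f e x, hD.localInverse_apply_image, hD.localInverse_continuousAt,
    hD.to_localInverse.exists_lipschitzOnWith, hD.eventually_right_inverse⟩

end HasStrictDerivFormula

end Derivatives

/-- Local solvability, with Lipschitz dependence on `Λ`, of a Riccati equation coupled with the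
Lyapunov equation of its closed-loop matrix. -/
theorem exists_local_riccati_lyapunov {n m : ℕ} {A Q G H C P₀ X₀ : Matrix (Fin n) (Fin n) ℝ}
    {B : Matrix (Fin n) (Fin m) ℝ} (hG : Gᵀ = G) (hP₀ : P₀ᵀ = P₀)
    (hN : IsHurwitz (A + G * P₀))
    (hric : Aᵀ * P₀ + P₀ * A + Q + P₀ * G * P₀ = 0)
    (hlyap : (A + G * P₀) * X₀ + X₀ * (A + G * P₀)ᵀ + C + P₀ * H + H * P₀ = 0) :
    ∃ p x : Matrix (Fin m) (Fin n) ℝ → Matrix (Fin n) (Fin n) ℝ,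
      p 0 = P₀ ∧ ContinuousAt p 0 ∧
      (∃ K, ∃ s ∈ 𝓝 (0 : Matrix (Fin m) (Fin n) ℝ),
        LipschitzOnWith K p s ∧ LipschitzOnWith K x s) ∧
      ∀ᶠ Λ in 𝓝 0,
        (A + B * Λ)ᵀ * p Λ + p Λ * (A + B * Λ) + Q + p Λ * G * p Λ = 0 ∧
        (A + B * Λ + G * p Λ) * x Λ + x Λ * (A + B * Λ + G * p Λ)ᵀ + C + p Λ * H + H * p Λ
          = 0 := by
  let V := Matrix (Fin m) (Fin n) ℝ × Matrix (Fin n) (Fin n) ℝ × Matrix (Fin n) (Fin n) ℝ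
  let z₀ : V := (0, P₀, X₀)
  have hΛ : HasStrictDerivFormula (fun z : V => z.1) (fun d => d.1) z₀ :=
    (ContinuousLinearMap.fst ℝ _ _).hasStrictDerivFormula z₀
  have hP : HasStrictDerivFormula (fun z : V => z.2.1) (fun d => d.2.1) z₀ :=
    ((ContinuousLinearMap.fst ℝ _ _).comp
      (ContinuousLinearMap.snd ℝ _ _)).hasStrictDerivFormula z₀
  have hX : HasStrictDerivFormula (fun z : V => z.2.2) (fun d => d.2.2) z₀ :=
    ((ContinuousLinearMap.snd ℝ _ _).comp
      (ContinuousLinearMap.snd ℝ _ _)).hasStrictDerivFormula z₀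
  have cst : ∀ {k l : ℕ} (M : Matrix (Fin k) (Fin l) ℝ),
    HasStrictDerivFormula (fun _ : V => M) (fun _ => 0) z₀ :=
      fun M => hasStrictDerivFormula_const M z₀
  have hAΛ := (cst A).add ((cst B).matrix_mul hΛ)
  have hN' := hAΛ.add ((cst G).matrix_mul hP)
  have hF := (((hAΛ.matrix_transpose.matrix_mul hP).add (hP.matrix_mul hAΛ)).add (cst Q)).add
    ((hP.matrix_mul (cst G)).matrix_mul hP)
  have hY := ((((hN'.matrix_mul hX).add (hX.matrix_mul hN'.matrix_transpose)).add (cst C)).add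
    (hP.matrix_mul (cst H))).add ((cst H).matrix_mul hP)
  let Ψ : V → V := fun z => (z.1, (A + B * z.1)ᵀ * z.2.1 + z.2.1 * (A + B * z.1) + Q +
    z.2.1 * G * z.2.1, (A + B * z.1 + G * z.2.1) * z.2.2 +
    z.2.2 * (A + B * z.1 + G * z.2.1)ᵀ + C + z.2.1 * H + H * z.2.1)
  have hΨ : HasStrictDerivFormula Ψ _ z₀ := hΛ.prodMk (hF.prodMk hY)
  have hz : Ψ z₀ = 0 := by
    simp only [Ψ, z₀, Matrix.mul_zero, add_zero, hric, hlyap]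
    rfl
  obtain ⟨g, hg0, hgc, ⟨K, s, hs, hgs⟩, hgr⟩ := hΨ.exists_local_rightInverse (by
    rintro ⟨a, b, c⟩ h
    have h1 : a = 0 := congrArg Prod.fst h
    have h2 := congrArg (fun z : V => z.2.1) h
    have h3 := congrArg (fun z : V => z.2.2) h
    subst h1
    change _ = (0 : Matrix (Fin n) (Fin n) ℝ) at h2
    change _ = (0 : Matrix (Fin n) (Fin n) ℝ) at h3
    simp only [z₀] at h2 h3
    have hb : b = 0 := by
      refine hN.transpose.eq_zero_of_mul_add_mul_eq_zero hN (Eq.trans ?_ h2)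
      simp only [Matrix.transpose_add, Matrix.transpose_mul, hP₀, hG, Matrix.mul_zero,
        Matrix.zero_mul, Matrix.transpose_zero, add_zero, zero_add, Matrix.add_mul,
        Matrix.mul_add, Matrix.mul_assoc]
      abel
    subst hb
    have hc : c = 0 := by
      refine hN.eq_zero_of_mul_add_mul_eq_zero hN.transpose (Eq.trans ?_ h3)
      simp
    rw [hc]
    rfl)
  rw [hz] at hg0 hgc hs hgr
  let ι : Matrix (Fin m) (Fin n) ℝ → V := fun Λ => (Λ, 0, 0)
  have hι : Tendsto ι (𝓝 0) (𝓝 0) :=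
    Continuous.tendsto' (by fun_prop) _ _ rfl
  have hιl : LipschitzWith 1 ι := LipschitzWith.of_dist_le_mul fun a b => by
    change max (dist a b) (max (dist (0 : Matrix (Fin n) (Fin n) ℝ) 0)
      (dist (0 : Matrix (Fin n) (Fin n) ℝ) 0)) ≤ _
    simp
  refine ⟨fun Λ => (g (ι Λ)).2.1, fun Λ => (g (ι Λ)).2.2, ?_, ?_, ?_, ?_⟩
  · exact congrArg (fun z : V => z.2.1) hg0
  · have : ContinuousAt (g ∘ ι) 0 := ContinuousAt.comp (x := 0) hgc hι
    exact this.snd.fst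
  · have hl := hgs.comp (hιl.lipschitzOnWith (s := ι ⁻¹' s)) (fun _ h => h)
    rw [mul_one] at hl
    refine ⟨K, ι ⁻¹' s, hι hs, ?_, ?_⟩
    · have := (LipschitzWith.prod_fst.comp LipschitzWith.prod_snd).comp_lipschitzOnWith hl
      rwa [one_mul, one_mul] at this
    · have := (LipschitzWith.prod_snd.comp LipschitzWith.prod_snd).comp_lipschitzOnWith hl
      rwa [one_mul, one_mul] at this
  · filter_upwards [hι.eventually hgr] with Λ h
    have h1 : (g (ι Λ)).1 = Λ := congrArg Prod.fst h
    have h2 := congrArg (fun z : V => z.2.1) h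
    have h3 := congrArg (fun z : V => z.2.2) h
    simp only [Ψ, h1] at h2 h3
    exact ⟨h2, h3⟩

theorem Matrix.IsHermitian.transpose_eq {m : ℕ} {M : Matrix (Fin m) (Fin m) ℝ}
    (hM : M.IsHermitian) : Mᵀ = M := by
  simpa using hM.eq

theorem transpose_mul_inv_mul_transpose {R : Matrix (Fin m_a) (Fin m_a) ℝ} (hR : R.PosDef)
    (Ba : Matrix (Fin n) (Fin m_a) ℝ) : (Ba * R⁻¹ * Baᵀ)ᵀ = Ba * R⁻¹ * Baᵀ := by
  simp only [Matrix.transpose_mul, Matrix.transpose_nonsing_inv, hR.1.transpose_eq,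
    Matrix.transpose_transpose, Matrix.mul_assoc]

theorem Matrix.IsHermitian.of_transpose_eq {m : ℕ} {M : Matrix (Fin m) (Fin m) ℝ}
    (hM : Mᵀ = M) : M.IsHermitian := by
  rwa [Matrix.IsHermitian, Matrix.conjTranspose_eq_transpose_of_trivial]

theorem riccati_unique {A G Q P₁ P₂ : Matrix (Fin n) (Fin n) ℝ} (hG : Gᵀ = G)
    (h₁ : Aᵀ * P₁ + P₁ * A + Q + P₁ * G * P₁ = 0)
    (h₂ : Aᵀ * P₂ + P₂ * A + Q + P₂ * G * P₂ = 0) (hN₁ : IsHurwitz (A + G * P₁ᵀ))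
    (hN₂ : IsHurwitz (A + G * P₂)) : P₁ = P₂ := by
  refine sub_eq_zero.1 (hN₁.transpose.eq_zero_of_mul_add_mul_eq_zero hN₂ ?_)
  rw [← sub_eq_zero.2 (h₁.trans h₂.symm)]
  simp only [Matrix.transpose_add, Matrix.transpose_mul, Matrix.transpose_transpose, hG,
    Matrix.add_mul, Matrix.mul_add, Matrix.mul_sub, Matrix.sub_mul, Matrix.mul_assoc]
  abel

theorem lyapunov_unique {N C X₁ X₂ : Matrix (Fin n) (Fin n) ℝ} (hN : IsHurwitz N)
    (h₁ : N * X₁ + X₁ * Nᵀ + C = 0) (h₂ : N * X₂ + X₂ * Nᵀ + C = 0) : X₁ = X₂ := by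
  refine sub_eq_zero.1 (hN.eq_zero_of_mul_add_mul_eq_zero hN.transpose ?_)
  rw [← sub_eq_zero.2 (h₁.trans h₂.symm), Matrix.mul_sub, Matrix.sub_mul]
  abel

theorem IsStabSol.riccati {A Q P : Matrix (Fin n) (Fin n) ℝ} {Bu : Matrix (Fin n) (Fin m_u) ℝ}
    {Ba : Matrix (Fin n) (Fin m_a) ℝ} {R : Matrix (Fin m_a) (Fin m_a) ℝ}
    {Λ : Matrix (Fin m_u) (Fin n) ℝ} (h : IsStabSol A Bu Ba Q R Λ P) :
    (A + Bu * Λ)ᵀ * P + P * (A + Bu * Λ) + Q + P * (Ba * R⁻¹ * Baᵀ) * P = 0 := by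
  simpa only [Matrix.mul_assoc] using h.2.1

theorem IsLyapSol.lyapunov {A P X : Matrix (Fin n) (Fin n) ℝ} {Bu : Matrix (Fin n) (Fin m_u) ℝ}
    {Ba : Matrix (Fin n) (Fin m_a) ℝ} {R : Matrix (Fin m_a) (Fin m_a) ℝ}
    {Kbar : Matrix (Fin m_a) (Fin n) ℝ} {Λ : Matrix (Fin m_u) (Fin n) ℝ}
    (h : IsLyapSol A Bu Ba R Kbar Λ P X) :
    (A + Bu * Λ + Ba * R⁻¹ * Baᵀ * P) * X + X * (A + Bu * Λ + Ba * R⁻¹ * Baᵀ * P)ᵀ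
      + -(Kbarᵀ * R⁻¹ * Baᵀ + Ba * R⁻¹ * Kbar)
      + P * (Ba * (R⁻¹ * R⁻¹) * Baᵀ) + Ba * (R⁻¹ * R⁻¹) * Baᵀ * P = 0 := by
  rw [← h.2]
  simp only [Matrix.mul_assoc]
  abel

/-- Near a point where it exists, the stabilizing solution persists, and it depends on the gain
in a Lipschitz way, as does the associated Lyapunov solution. -/
theorem exists_lipschitz_stabSol
    {A : Matrix (Fin n) (Fin n) ℝ} {Bu : Matrix (Fin n) (Fin m_u) ℝ}
    {Ba : Matrix (Fin n) (Fin m_a) ℝ}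
    {Q : Matrix (Fin n) (Fin n) ℝ} {R : Matrix (Fin m_a) (Fin m_a) ℝ} (hR : R.PosDef)
    (hQ : Q.PosDef)
    {Kbar : Matrix (Fin m_a) (Fin n) ℝ}
    {Pu Pim : Matrix (Fin m_u) (Fin n) ℝ → Matrix (Fin n) (Fin n) ℝ}
    (hPu : ∀ Λ, (∃ P, IsStabSol A Bu Ba Q R Λ P) → IsStabSol A Bu Ba Q R Λ (Pu Λ))
    (hPim : ∀ Λ, (∃ P, IsStabSol A Bu Ba Q R Λ P) →
      IsLyapSol A Bu Ba R Kbar Λ (Pu Λ) (Pim Λ))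
    (h0 : ∃ P, IsStabSol A Bu Ba Q R 0 P)
    {S : Matrix (Fin n) (Fin n) ℝ} (hS : S.PosDef)
    (hSeq : (A + Ba * R⁻¹ * Baᵀ * Pu 0)ᵀ * S + S * (A + Ba * R⁻¹ * Baᵀ * Pu 0)
      + (2 : ℝ) • (1 : Matrix (Fin n) (Fin n) ℝ) = 0) :
    ∃ r > 0, ∃ c > 0, (∀ Λ, ‖Λ‖ ≤ r → ∃ P, IsStabSol A Bu Ba Q R Λ P) ∧
      ∀ Λ₁ Λ₂, ‖Λ₁‖ ≤ r → ‖Λ₂‖ ≤ r →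
        ‖Pu Λ₁ - Pu Λ₂‖ ≤ c * ‖Λ₁ - Λ₂‖ ∧ ‖Pim Λ₁ - Pim Λ₂‖ ≤ c * ‖Λ₁ - Λ₂‖ := by
  have hP₀ := hPu 0 h0
  have hX₀ := hPim 0 h0
  have hG := transpose_mul_inv_mul_transpose hR Ba
  have hric := hP₀.riccati
  have hlyap := hX₀.lyapunov
  have hN := hP₀.2.2
  simp only [Matrix.mul_zero, add_zero] at hric hlyap hN
  obtain ⟨p, x, hp0, hpc, ⟨K, s, hs, hps, hxs⟩, hpx⟩ :=
    exists_local_riccati_lyapunov (B := Bu) hG hP₀.1.1.transpose_eq hN hric hlyap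
  set G := Ba * R⁻¹ * Baᵀ with hGdef
  have hNc : Tendsto (fun Λ => -((A + Bu * Λ + G * p Λ)ᵀ * S + S * (A + Bu * Λ + G * p Λ)))
      (𝓝 0) (𝓝 ((2 : ℝ) • 1)) := by
    have hN0 : -((A + G * Pu 0)ᵀ * S + S * (A + G * Pu 0)) = (2 : ℝ) • 1 := by
      rw [neg_eq_iff_add_eq_zero]
      exact hSeq
    have h1 : Tendsto (fun Λ => A + Bu * Λ + G * p Λ) (𝓝 0) (𝓝 (A + G * Pu 0)) := by
      refine Tendsto.add (Continuous.tendsto' (by fun_prop) _ _ (by simp)) ?_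
      exact (Continuous.tendsto' (f := fun M => G * M) (by fun_prop) _ _ (by rw [hp0])).comp hpc
    rw [← hN0]
    exact (Continuous.tendsto' (f := fun M : Matrix (Fin n) (Fin n) ℝ => -(Mᵀ * S + S * M))
      (by fun_prop) _ _ rfl).comp h1
  have hev : ∀ᶠ Λ in 𝓝 0, IsStabSol A Bu Ba Q R Λ (Pu Λ) ∧ Pu Λ = p Λ ∧ Pim Λ = x Λ := by
    have h2 : ((2 : ℝ) • (1 : Matrix (Fin n) (Fin n) ℝ)).PosDef := Matrix.PosDef.one.smul two_pos
    have hp0' : Tendsto p (𝓝 0) (𝓝 (Pu 0)) := hp0 ▸ hpc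
    filter_upwards [hpx, hNc.eventually h2.eventually_posDef,
      hp0'.eventually hP₀.1.eventually_posDef] with Λ h hpos hpd
    have hN := isHurwitz_of_posDef hS (hpos (.of_transpose_eq (by
      simp only [Matrix.transpose_neg, Matrix.transpose_add, Matrix.transpose_mul,
        Matrix.transpose_transpose, hS.1.transpose_eq]
      abel)))
    have hsymm : (p Λ)ᵀ = p Λ := by
      refine riccati_unique hG ?_ h.1 (by rwa [Matrix.transpose_transpose]) hN
      have := congrArg Matrix.transpose h.1
      simp only [Matrix.transpose_add, Matrix.transpose_mul, Matrix.transpose_transpose, hG,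
        hQ.1.transpose_eq, Matrix.transpose_zero] at this ⊢
      rw [← this]
      simp only [Matrix.mul_assoc]
      abel
    have hstab : IsStabSol A Bu Ba Q R Λ (p Λ) :=
      ⟨hpd (.of_transpose_eq hsymm), by simpa only [hGdef, Matrix.mul_assoc] using h.1, hN⟩
    have hPΛ := hPu Λ ⟨_, hstab⟩
    have hPeq : Pu Λ = p Λ :=
      riccati_unique hG hPΛ.riccati h.1 (by rw [hPΛ.1.1.transpose_eq]; exact hPΛ.2.2) hN
    refine ⟨hPΛ, hPeq, ?_⟩
    have hX := (hPim Λ ⟨_, hstab⟩).lyapunov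
    rw [hPeq] at hX
    have hx := h.2
    rw [add_assoc, add_assoc] at hX hx
    exact lyapunov_unique hN hX hx
  obtain ⟨r, hr, hball⟩ := Metric.nhds_basis_closedBall.mem_iff.1 (hev.and hs)
  have hmem : ∀ Λ, ‖Λ‖ ≤ r → _ := fun Λ hΛ => hball (mem_closedBall_zero_iff.2 hΛ)
  refine ⟨r, hr, K + 1, by positivity, fun Λ hΛ => ⟨_, (hmem Λ hΛ).1.1⟩, fun Λ₁ Λ₂ h₁ h₂ => ?_⟩
  obtain ⟨⟨-, hp₁, hx₁⟩, hs₁⟩ := hmem Λ₁ h₁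
  obtain ⟨⟨-, hp₂, hx₂⟩, hs₂⟩ := hmem Λ₂ h₂
  rw [hp₁, hp₂, hx₁, hx₂]
  have hK : K * ‖Λ₁ - Λ₂‖ ≤ (K + 1) * ‖Λ₁ - Λ₂‖ := by
    gcongr
    linarith
  exact ⟨(hps.norm_sub_le hs₁ hs₂).trans hK, (hxs.norm_sub_le hs₁ hs₂).trans hK⟩

theorem trace_lyapunov_mul_sub {A F G P P' Q W X : Matrix (Fin n) (Fin n) ℝ} (hG : Gᵀ = G)
    (hPt : Pᵀ = P) (hPt' : P'ᵀ = P') (hXt : Xᵀ = X)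
    (hP : (A + F)ᵀ * P + P * (A + F) + Q + P * G * P = 0)
    (hP' : Aᵀ * P' + P' * A + Q + P' * G * P' = 0)
    (hX : (A + G * P') * X + X * (A + G * P')ᵀ + W = 0) :
    (W * (P - P')).trace = 2 * (X * P' * F).trace + 2 * (X * (P - P') * F).trace
      + (X * (P - P') * G * (P - P')).trace := by
  have hD : (A + G * P')ᵀ * (P - P') + (P - P') * (A + G * P')
      = -(Fᵀ * P + P * F + (P - P') * G * (P - P')) := by
    rw [eq_neg_iff_add_eq_zero, ← sub_eq_zero.2 (hP.trans hP'.symm)]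
    simp only [Matrix.transpose_add, Matrix.transpose_mul, hPt', hG, Matrix.add_mul,
      Matrix.mul_add, Matrix.mul_sub, Matrix.sub_mul, Matrix.mul_assoc]
    abel
  have hW : W = -((A + G * P') * X + X * (A + G * P')ᵀ) := (neg_eq_of_add_eq_zero_right hX).symm
  have h1 : (W * (P - P')).trace
      = -(X * ((A + G * P')ᵀ * (P - P') + (P - P') * (A + G * P'))).trace := by
    rw [hW, Matrix.neg_mul, Matrix.trace_neg, Matrix.add_mul, Matrix.mul_add, Matrix.trace_add,
      Matrix.trace_add, Matrix.mul_assoc _ X, Matrix.trace_mul_comm, Matrix.mul_assoc X,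
      Matrix.mul_assoc X, add_comm]
  have h2 : (X * (Fᵀ * P)).trace = (X * (P * F)).trace := by
    rw [← Matrix.trace_transpose, Matrix.transpose_mul, Matrix.transpose_mul, hXt, hPt,
      Matrix.transpose_transpose, Matrix.trace_mul_comm]
  have h3 : (X * (P * F)).trace = (X * P' * F).trace + (X * (P - P') * F).trace := by
    rw [← Matrix.trace_add, Matrix.mul_sub, Matrix.sub_mul, add_sub_cancel, Matrix.mul_assoc]
  rw [h1, hD, Matrix.mul_neg, Matrix.trace_neg, neg_neg, Matrix.mul_add, Matrix.mul_add,
    Matrix.trace_add, Matrix.trace_add, h2, h3]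
  simp only [Matrix.mul_assoc]
  ring

theorem norm_sq_add_trace_le {m : ℕ} (M K : Matrix (Fin m) (Fin n) ℝ)
    {P P' : Matrix (Fin n) (Fin n) ℝ} (hPt : Pᵀ = P) (hPt' : P'ᵀ = P') :
    ‖M * P' - K‖ ^ 2 + ((-(Kᵀ * M + Mᵀ * K) + P' * (Mᵀ * M) + Mᵀ * M * P') * (P - P')).trace
      ≤ ‖M * P - K‖ ^ 2 := by
  set D := P - P' with hD
  have hDt : Dᵀ = D := by rw [hD, Matrix.transpose_sub, hPt, hPt']
  have hP : M * P - K = M * P' - K + M * D := by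
    rw [hD, Matrix.mul_sub]
    abel
  have h1 : (Mᵀ * (K * D)).trace = (Kᵀ * (M * D)).trace := by
    rw [← Matrix.trace_transpose]
    simp only [Matrix.transpose_mul, Matrix.transpose_transpose, hDt]
    rw [Matrix.mul_assoc, Matrix.trace_mul_comm, Matrix.mul_assoc]
  have h2 : (Mᵀ * (M * (P' * D))).trace = (P' * (Mᵀ * (M * D))).trace := by
    rw [← Matrix.trace_transpose]
    simp only [Matrix.transpose_mul, Matrix.transpose_transpose, hDt, hPt', Matrix.mul_assoc]
    rw [Matrix.trace_mul_comm]
    simp only [Matrix.mul_assoc]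
  have h3 : (Dᵀ * (Mᵀ * (M * P' - K))).trace = ((M * P' - K)ᵀ * (M * D)).trace := by
    rw [← Matrix.trace_transpose]
    simp only [Matrix.transpose_mul, Matrix.transpose_transpose, Matrix.mul_assoc]
  have h4 := sq_nonneg ‖M * D‖
  rw [hP, ← trace_transpose_mul_self, ← trace_transpose_mul_self (M * P' - K + M * D)]
  rw [← trace_transpose_mul_self] at h4
  simp only [Matrix.transpose_add, Matrix.add_mul, Matrix.mul_add, Matrix.trace_add,
    Matrix.neg_mul, Matrix.trace_neg, Matrix.mul_assoc, h1, h2, h3, Matrix.transpose_mul M D] at *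
  simp only [Matrix.transpose_sub, Matrix.transpose_mul, hPt', Matrix.sub_mul, Matrix.trace_sub,
    Matrix.mul_assoc] at *
  linarith

/-- Near a point where the stabilizing solution exists, half the gradient of the unregularized
cost is Lipschitz and the cost is bounded below by its linearization up to a quadratic error. -/
theorem exists_semiconvex_cost
    {A : Matrix (Fin n) (Fin n) ℝ} {Bu : Matrix (Fin n) (Fin m_u) ℝ}
    {Ba : Matrix (Fin n) (Fin m_a) ℝ}
    {Q : Matrix (Fin n) (Fin n) ℝ} {R : Matrix (Fin m_a) (Fin m_a) ℝ} (hR : R.PosDef)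
    (hQ : Q.PosDef)
    {Kbar : Matrix (Fin m_a) (Fin n) ℝ}
    {Pu Pim : Matrix (Fin m_u) (Fin n) ℝ → Matrix (Fin n) (Fin n) ℝ}
    (hPu : ∀ Λ, (∃ P, IsStabSol A Bu Ba Q R Λ P) → IsStabSol A Bu Ba Q R Λ (Pu Λ))
    (hPim : ∀ Λ, (∃ P, IsStabSol A Bu Ba Q R Λ P) →
      IsLyapSol A Bu Ba R Kbar Λ (Pu Λ) (Pim Λ))
    (h0 : ∃ P, IsStabSol A Bu Ba Q R 0 P)
    {S : Matrix (Fin n) (Fin n) ℝ} (hS : S.PosDef)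
    (hSeq : (A + Ba * R⁻¹ * Baᵀ * Pu 0)ᵀ * S + S * (A + Ba * R⁻¹ * Baᵀ * Pu 0)
      + (2 : ℝ) • (1 : Matrix (Fin n) (Fin n) ℝ) = 0) :
    ∃ r > 0, ∃ c > 0, (∀ Λ, ‖Λ‖ ≤ r → ∃ P, IsStabSol A Bu Ba Q R Λ P) ∧
      ∀ Λ₁ Λ₂, ‖Λ₁‖ ≤ r → ‖Λ₂‖ ≤ r →
        ‖Buᵀ * Pu Λ₁ * Pim Λ₁ - Buᵀ * Pu Λ₂ * Pim Λ₂‖ ≤ c * ‖Λ₁ - Λ₂‖ ∧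
        ‖R⁻¹ * Baᵀ * Pu Λ₂ - Kbar‖ ^ 2
          + 2 * ((Buᵀ * Pu Λ₂ * Pim Λ₂)ᵀ * (Λ₁ - Λ₂)).trace - c * ‖Λ₁ - Λ₂‖ ^ 2
          ≤ ‖R⁻¹ * Baᵀ * Pu Λ₁ - Kbar‖ ^ 2 := by
  obtain ⟨r, hr, k, hk, hex, hlip⟩ := exists_lipschitz_stabSol hR hQ hPu hPim h0 hS hSeq
  have hG := transpose_mul_inv_mul_transpose hR Ba
  set G := Ba * R⁻¹ * Baᵀ
  have hbd : ∀ Λ, ‖Λ‖ ≤ r → ‖Pu Λ‖ ≤ ‖Pu 0‖ + k * r ∧ ‖Pim Λ‖ ≤ ‖Pim 0‖ + k * r := by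
    intro Λ hΛ
    obtain ⟨h1, h2⟩ := hlip Λ 0 hΛ (by simpa using hr.le)
    have h3 : k * ‖Λ - 0‖ ≤ k * r := by
      rw [sub_zero]
      gcongr
    exact ⟨(norm_le_norm_add_norm_sub' _ _).trans (by gcongr; exact h1.trans h3),
      (norm_le_norm_add_norm_sub' _ _).trans (by gcongr; exact h2.trans h3)⟩
  set a := ‖Pu 0‖ + k * r
  set b := ‖Pim 0‖ + k * r
  have ha0 : 0 ≤ a := by positivity
  have hb0 : 0 ≤ b := by positivity
  set c₁ := ‖Bu‖ * (k * b + a * k)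
  set c₂ := 2 * (b * k * ‖Bu‖) + b * k * ‖G‖ * k with hc₂
  have hc₁0 : 0 ≤ c₁ := by positivity
  have hc₂0 : 0 ≤ c₂ := by positivity
  refine ⟨r, hr, c₁ + c₂ + 1, by positivity, hex, fun Λ₁ Λ₂ h₁ h₂ => ⟨?_, ?_⟩⟩
  all_goals obtain ⟨hP, hX⟩ := hlip Λ₁ Λ₂ h₁ h₂
  · have e : Buᵀ * Pu Λ₁ * Pim Λ₁ - Buᵀ * Pu Λ₂ * Pim Λ₂
        = Buᵀ * ((Pu Λ₁ - Pu Λ₂) * Pim Λ₁ + Pu Λ₂ * (Pim Λ₁ - Pim Λ₂)) := by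
      simp only [Matrix.mul_add, Matrix.mul_sub, Matrix.sub_mul, Matrix.mul_assoc]
      abel
    calc _ ≤ ‖Bu‖ * (k * ‖Λ₁ - Λ₂‖ * b + a * (k * ‖Λ₁ - Λ₂‖)) := by
          rw [e, ← Matrix.frobenius_norm_transpose Bu]
          refine (Matrix.frobenius_norm_mul _ _).trans ?_
          gcongr
          refine (norm_add_le _ _).trans ?_
          gcongr
          · refine (Matrix.frobenius_norm_mul _ _).trans ?_
            gcongr
            exact (hbd Λ₁ h₁).2
          · refine (Matrix.frobenius_norm_mul _ _).trans ?_
            gcongr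
            exact (hbd Λ₂ h₂).1
      _ = c₁ * ‖Λ₁ - Λ₂‖ := by ring
      _ ≤ _ := by gcongr; linarith
  · have hs₁ := hPu Λ₁ (hex Λ₁ h₁)
    have hs₂ := hPu Λ₂ (hex Λ₂ h₂)
    have hl := hPim Λ₂ (hex Λ₂ h₂)
    have hMt : (R⁻¹ * Baᵀ)ᵀ = Ba * R⁻¹ := by
      rw [Matrix.transpose_mul, Matrix.transpose_nonsing_inv, hR.1.transpose_eq,
        Matrix.transpose_transpose]
    have h3 := norm_sq_add_trace_le (R⁻¹ * Baᵀ) Kbar hs₁.1.1.transpose_eq hs₂.1.1.transpose_eq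
    have hric := hs₁.riccati
    have hA : A + Bu * Λ₁ = A + Bu * Λ₂ + Bu * (Λ₁ - Λ₂) := by
      rw [Matrix.mul_sub]
      abel
    rw [hA] at hric
    have hlyap := hl.lyapunov
    rw [add_assoc, add_assoc] at hlyap
    have h4 := trace_lyapunov_mul_sub hG hs₁.1.1.transpose_eq hs₂.1.1.transpose_eq
      hl.1.transpose_eq hric hs₂.riccati hlyap
    set X := Pim Λ₂
    set D := Pu Λ₁ - Pu Λ₂
    set E := Λ₁ - Λ₂
    have hXb : ‖X‖ ≤ b := (hbd Λ₂ h₂).2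
    have h5 : -(b * (k * ‖E‖) * (‖Bu‖ * ‖E‖)) ≤ (X * D * (Bu * E)).trace := by
      refine neg_le.1 ((neg_le_abs _).trans ((abs_trace_mul_le _ _).trans ?_))
      gcongr
      · refine (Matrix.frobenius_norm_mul _ _).trans ?_
        gcongr
      · exact Matrix.frobenius_norm_mul _ _
    have h6 : -(b * (k * ‖E‖) * ‖G‖ * (k * ‖E‖)) ≤ (X * D * G * D).trace := by
      refine neg_le.1 ((neg_le_abs _).trans ((abs_trace_mul_le _ _).trans ?_))
      gcongr
      refine (Matrix.frobenius_norm_mul _ _).trans ?_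
      gcongr
      refine (Matrix.frobenius_norm_mul _ _).trans ?_
      gcongr
    have h7 : ((Buᵀ * Pu Λ₂ * X)ᵀ * E).trace = (X * Pu Λ₂ * (Bu * E)).trace := by
      simp only [Matrix.transpose_mul, Matrix.transpose_transpose, hl.1.transpose_eq,
        hs₂.1.1.transpose_eq, Matrix.mul_assoc]
    have h8 : -(Kbarᵀ * (R⁻¹ * Baᵀ) + (R⁻¹ * Baᵀ)ᵀ * Kbar)
        + Pu Λ₂ * ((R⁻¹ * Baᵀ)ᵀ * (R⁻¹ * Baᵀ)) + (R⁻¹ * Baᵀ)ᵀ * (R⁻¹ * Baᵀ) * Pu Λ₂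
        = -(Kbarᵀ * R⁻¹ * Baᵀ + Ba * R⁻¹ * Kbar)
          + (Pu Λ₂ * (Ba * (R⁻¹ * R⁻¹) * Baᵀ) + Ba * (R⁻¹ * R⁻¹) * Baᵀ * Pu Λ₂) := by
      rw [hMt]
      simp only [Matrix.mul_assoc, add_assoc]
    rw [h8, h4] at h3
    rw [h7]
    have h9 : 0 ≤ (c₁ + 1) * ‖E‖ ^ 2 := by positivity
    have h10 : (c₁ + c₂ + 1) * ‖E‖ ^ 2 = (c₁ + 1) * ‖E‖ ^ 2
        + (2 * (b * (k * ‖E‖) * (‖Bu‖ * ‖E‖)) + b * (k * ‖E‖) * ‖G‖ * (k * ‖E‖)) := by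
      rw [hc₂]
      ring
    linarith

theorem exists_add_eq_zero_of_lipschitz {m q : ℕ} {Γ : Matrix (Fin m) (Fin m) ℝ} {γ c r : ℝ}
    (hΓ : Γ.PosDef) (hΓγ : (Γ - γ • (1 : Matrix (Fin m) (Fin m) ℝ)).PosDef) (hc : 0 < c)
    (hr : 0 ≤ r) {h : Matrix (Fin m) (Fin q) ℝ → Matrix (Fin m) (Fin q) ℝ}
    (hlip : ∀ Λ₁ Λ₂, ‖Λ₁‖ ≤ r → ‖Λ₂‖ ≤ r → ‖h Λ₁ - h Λ₂‖ ≤ c * ‖Λ₁ - Λ₂‖)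
    (hγ : 4 * c ≤ γ) (hγr : ‖h 0‖ + c * r ≤ γ * r) :
    ∃ Λ, ‖Λ‖ ≤ r ∧ Γ * Λ + h Λ = 0 := by
  have hdet : IsUnit Γ.det := hΓ.det_pos.ne'.isUnit
  have hγ0 : 0 < γ := by linarith
  have hinv : ∀ X : Matrix (Fin m) (Fin q) ℝ, γ * ‖Γ⁻¹ * X‖ ≤ ‖X‖ := fun X => by
    simpa [Matrix.mul_nonsing_inv_cancel_left _ _ hdet] using
      mul_norm_le_norm_mul hΓγ (Γ⁻¹ * X)
  let T : Matrix (Fin m) (Fin q) ℝ → Matrix (Fin m) (Fin q) ℝ := fun Λ => -(Γ⁻¹ * h Λ)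
  have hmaps : Set.MapsTo T (Metric.closedBall 0 r) (Metric.closedBall 0 r) := by
    intro Λ hΛ
    rw [mem_closedBall_zero_iff] at hΛ ⊢
    have h1 := hlip Λ 0 hΛ (by simpa using hr)
    rw [sub_zero] at h1
    have h2 := norm_le_norm_add_norm_sub' (h Λ) (h 0)
    have h3 := hinv (h Λ)
    have h4 : c * ‖Λ‖ ≤ c * r := by gcongr
    have h5 : γ * ‖T Λ‖ ≤ γ * r := by
      rw [norm_neg]
      linarith
    exact le_of_mul_le_mul_left h5 hγ0
  have hcontr : ContractingWith (1 / 4) (hmaps.restrict T _ _) := by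
    refine ⟨by norm_num, LipschitzWith.of_dist_le_mul ?_⟩
    rintro ⟨Λ₁, h₁⟩ ⟨Λ₂, h₂⟩
    rw [mem_closedBall_zero_iff] at h₁ h₂
    rw [Subtype.dist_eq, Subtype.dist_eq, dist_eq_norm, dist_eq_norm]
    simp only [Set.MapsTo.val_restrict_apply, T]
    have h3 := hinv (h Λ₁ - h Λ₂)
    have h4 := hlip Λ₁ Λ₂ h₁ h₂
    have h5 : -(Γ⁻¹ * h Λ₁) - -(Γ⁻¹ * h Λ₂) = -(Γ⁻¹ * (h Λ₁ - h Λ₂)) := by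
      rw [Matrix.mul_sub]
      abel
    rw [h5, norm_neg]
    have h6 : 4 * c * ‖Λ₁ - Λ₂‖ ≤ γ * ‖Λ₁ - Λ₂‖ := by gcongr
    refine le_of_mul_le_mul_left (a := γ) ?_ hγ0
    push_cast
    linarith
  obtain ⟨Λ, hΛ, hfix, -⟩ := hcontr.exists_fixedPoint' Metric.isClosed_closedBall.isComplete hmaps
    (Metric.mem_closedBall_self hr) (edist_ne_top _ _)
  refine ⟨Λ, mem_closedBall_zero_iff.1 hΛ, ?_⟩
  have h1 : Λ = -(Γ⁻¹ * h Λ) := hfix.symm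
  have h2 : Γ * Λ = -(h Λ) := by
    conv_lhs => rw [h1]
    rw [Matrix.mul_neg, Matrix.mul_nonsing_inv_cancel_left _ _ hdet]
  rw [h2, neg_add_cancel]

theorem tendsto_of_norm_sub_succ_le {E : Type*} [NormedAddCommGroup E] {u : ℕ → E} {a : E}
    {q r : ℝ} (hq₀ : 0 ≤ q) (hq : q < 1) (hr : ‖u 0 - a‖ ≤ r)
    (hu : ∀ i, ‖u i - a‖ ≤ r → ‖u (i + 1) - a‖ ≤ q * ‖u i - a‖) :
    Tendsto (fun i => ‖u i - a‖) atTop (𝓝 0) := by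
  have hle : ∀ i, ‖u i - a‖ ≤ q ^ i * ‖u 0 - a‖ := by
    intro i
    induction i with
    | zero => simp
    | succ i ih =>
      have h1 : q ^ i * ‖u 0 - a‖ ≤ 1 * ‖u 0 - a‖ := by
        gcongr
        exact pow_le_one₀ hq₀ hq.le
      refine (hu i (by linarith)).trans ?_
      rw [pow_succ', mul_assoc]
      gcongr
  refine squeeze_zero (fun i => norm_nonneg _) hle ?_
  simpa using (tendsto_pow_atTop_nhds_zero_of_lt_one hq₀ hq).mul_const ‖u 0 - a‖

theorem trace_quadratic_expansion {m q : ℕ} {Γ : Matrix (Fin m) (Fin m) ℝ} (hΓ : Γᵀ = Γ)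
    (Λ Λ' : Matrix (Fin m) (Fin q) ℝ) :
    (Λᵀ * Γ * Λ).trace = (Λ'ᵀ * Γ * Λ').trace + 2 * ((Γ * Λ')ᵀ * (Λ - Λ')).trace
      + ((Λ - Λ')ᵀ * Γ * (Λ - Λ')).trace := by
  have h : (Λ'ᵀ * (Γ * Λ)).trace = (Λᵀ * (Γ * Λ')).trace := by
    rw [← Matrix.trace_transpose]
    simp only [Matrix.transpose_mul, Matrix.transpose_transpose, hΓ, Matrix.mul_assoc]
  simp only [Matrix.transpose_mul, hΓ, Matrix.transpose_sub, Matrix.mul_sub, Matrix.sub_mul,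
    Matrix.mul_assoc, Matrix.trace_sub, h]
  ring

/-- The step size bound forces `ω < 4 / 3`, as `L` cannot be much smaller than the norm of `Γ`. -/
theorem stepSize_lt {m q : ℕ} {Γ : Matrix (Fin m) (Fin m) ℝ} {γ c L ω : ℝ}
    (hΓ : Γ.PosDef) (hΓγ : (Γ - γ • (1 : Matrix (Fin m) (Fin m) ℝ)).PosDef)
    (hγ : 4 * c ≤ γ) (hL : 0 < L) {E D : Matrix (Fin m) (Fin q) ℝ} (hE : E ≠ 0)
    (hD : ‖D‖ ≤ c * ‖E‖) (hED : ‖(2 : ℝ) • (Γ * E + D)‖ ≤ L * ‖E‖)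
    (hω : ω < (2 / L) * (eigMin Γ⁻¹ / (eigMax Γ⁻¹) ^ 2)) : ω < 4 / 3 := by
  have hE0 : 0 < ‖E‖ := norm_pos_iff.2 hE
  have h1 := mul_norm_le_norm_mul hΓγ E
  have h2 := norm_mul_le_eigMax_mul hΓ.inv (Γ * E)
  rw [Matrix.nonsing_inv_mul_cancel_left _ _ hΓ.det_pos.ne'.isUnit] at h2
  have h3 := eigMin_le_eigMax Γ⁻¹
  set l := eigMax Γ⁻¹
  have hΓE : 0 ≤ ‖Γ * E‖ := norm_nonneg _
  have hl : 0 < l := by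
    by_contra hl
    nlinarith
  have hΓE' : 0 < ‖Γ * E‖ := by
    by_contra h
    nlinarith
  have h4 : ‖Γ * E‖ ≤ ‖Γ * E + D‖ + ‖D‖ := by
    simpa using norm_sub_le (Γ * E + D) D
  rw [norm_smul, Real.norm_eq_abs, abs_two] at hED
  have h5 : 4 * c * ‖E‖ ≤ γ * ‖E‖ := by gcongr
  have h6 : L * ‖E‖ ≤ L * (l * ‖Γ * E‖) := by gcongr
  have h7 : 3 / 2 ≤ L * l := by
    refine le_of_mul_le_mul_right (a := ‖Γ * E‖) ?_ hΓE'
    linarith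
  refine hω.trans_le ?_
  calc (2 / L) * (eigMin Γ⁻¹ / l ^ 2) ≤ (2 / L) * (l / l ^ 2) := by gcongr
    _ = 2 / (L * l) := by field_simp
    _ ≤ 2 / (3 / 2) := by gcongr
    _ = 4 / 3 := by norm_num

end Frobenius

/-- Theorem 2, item 4: for a sufficiently large regularization
weight `Γ ≻ γ*I`, the iterates converge to a global minimizer of `J̃` over `S₀`. -/
theorem stmt9
    (A : Matrix (Fin n) (Fin n) ℝ) (Bu : Matrix (Fin n) (Fin m_u) ℝ)
    (Ba : Matrix (Fin n) (Fin m_a) ℝ)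
    (Q : Matrix (Fin n) (Fin n) ℝ) (R : Matrix (Fin m_a) (Fin m_a) ℝ)
    (hQ : Q.PosDef) (hR : R.PosDef)
    (Kbar : Matrix (Fin m_a) (Fin n) ℝ)
    (Pu Pim : Matrix (Fin m_u) (Fin n) ℝ → Matrix (Fin n) (Fin n) ℝ)
    (hPu : ∀ Λ, (∃ P, IsStabSol A Bu Ba Q R Λ P) → IsStabSol A Bu Ba Q R Λ (Pu Λ))
    (hPim : ∀ Λ, (∃ P, IsStabSol A Bu Ba Q R Λ P) →
      IsLyapSol A Bu Ba R Kbar Λ (Pu Λ) (Pim Λ))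
    (h0 : ∃ P, IsStabSol A Bu Ba Q R 0 P)
    (S : Matrix (Fin n) (Fin n) ℝ) (hS : S.PosDef)
    (hSeq : (A + Ba * (R⁻¹ * Baᵀ * Pu 0))ᵀ * S + S * (A + Ba * (R⁻¹ * Baᵀ * Pu 0))
      + (2 : ℝ) • (1 : Matrix (Fin n) (Fin n) ℝ) = 0) :
    ∃ γs : ℝ, 0 < γs ∧
      ∀ Γ : Matrix (Fin m_u) (Fin m_u) ℝ, Γ.PosDef →
        (Γ - γs • (1 : Matrix (Fin m_u) (Fin m_u) ℝ)).PosDef →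
        ∀ ε : ℝ, 0 < ε → ε < 1 →
          frobNorm (R⁻¹ * Baᵀ * Pu 0 - Kbar) ≤
            (ε / 2) * (Real.sqrt (eigMin Γ) /
              (Real.sqrt (eigMin Γ) * frobNorm (S * Ba) + frobNorm (S * Bu))) →
        ∀ L : ℝ, 0 < L →
          (∀ Λ₁ ∈ S0 A Bu Ba Q R Γ Kbar Pu, ∀ Λ₂ ∈ S0 A Bu Ba Q R Γ Kbar Pu,
            frobNorm ((2 : ℝ) • (Γ * Λ₁ + Buᵀ * Pu Λ₁ * Pim Λ₁) -
                (2 : ℝ) • (Γ * Λ₂ + Buᵀ * Pu Λ₂ * Pim Λ₂)) ≤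
              L * frobNorm (Λ₁ - Λ₂)) →
        ∀ ω : ℝ, 0 < ω → ω < (2 / L) * (eigMin Γ⁻¹ / (eigMax Γ⁻¹) ^ 2) →
        ∀ Λseq : ℕ → Matrix (Fin m_u) (Fin n) ℝ,
          Λseq 0 ∈ S0 A Bu Ba Q R Γ Kbar Pu →
          (∀ i, Λseq (i + 1) = Λseq i +
            ω • (-(Γ⁻¹ * (Buᵀ * Pu (Λseq i) * Pim (Λseq i))) - Λseq i)) →
          ∃ Λhat ∈ S0 A Bu Ba Q R Γ Kbar Pu,
            Filter.Tendsto (fun i => frobNorm (Λseq i - Λhat))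
              Filter.atTop (nhds 0) ∧
            ∀ Λ ∈ S0 A Bu Ba Q R Γ Kbar Pu,
              Jcost Ba R Γ Kbar Pu Λhat ≤ Jcost Ba R Γ Kbar Pu Λ := by
  open scoped Matrix.Norms.Frobenius in
  rw [← Matrix.mul_assoc Ba, ← Matrix.mul_assoc Ba] at hSeq
  obtain ⟨r, hr, c, hc, hex, hloc⟩ := exists_semiconvex_cost hR hQ hPu hPim h0 hS hSeq
  let h : Matrix (Fin m_u) (Fin n) ℝ → Matrix (Fin m_u) (Fin n) ℝ :=
    fun Λ => Buᵀ * Pu Λ * Pim Λ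
  set J₀ := ‖R⁻¹ * Baᵀ * Pu 0 - Kbar‖ ^ 2 with hJ₀
  refine ⟨4 * c + (‖h 0‖ + c * r) / r + 9 * J₀ / r ^ 2 + 1, by positivity, ?_⟩
  set γ := 4 * c + (‖h 0‖ + c * r) / r + 9 * J₀ / r ^ 2 + 1
  intro Γ hΓ hΓγ _ _ _ _ L hL hLip ω hω₀ hω Λseq hΛ₀ hΛseq
  have hγc : 4 * c ≤ γ := by
    have : 0 ≤ (‖h 0‖ + c * r) / r + 9 * J₀ / r ^ 2 := by positivity
    linarith
  have hγr : ‖h 0‖ + c * r ≤ γ * r := by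
    have : (‖h 0‖ + c * r) / r ≤ γ := by
      have : 0 ≤ 9 * J₀ / r ^ 2 := by positivity
      linarith
    rwa [div_le_iff₀ hr] at this
  have hγJ : 9 * J₀ ≤ γ * r ^ 2 := by
    have : 9 * J₀ / r ^ 2 ≤ γ := by
      have : 0 ≤ (‖h 0‖ + c * r) / r := by positivity
      linarith
    rwa [div_le_iff₀ (by positivity)] at this
  have hγ0 : 0 < γ := by linarith
  have hJ : ∀ Λ, Jcost Ba R Γ Kbar Pu Λ
      = ‖R⁻¹ * Baᵀ * Pu Λ - Kbar‖ ^ 2 + (Λᵀ * Γ * Λ).trace := fun Λ => by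
    rw [Jcost, frobNorm_eq_norm]
  have hJ0 : Jcost Ba R Γ Kbar Pu 0 = J₀ := by simp [hJ, hJ₀]
  have hball : ∀ Λ ∈ S0 A Bu Ba Q R Γ Kbar Pu, ‖Λ‖ ≤ r / 3 := by
    rintro Λ ⟨-, hΛ⟩
    rw [hJ0, hJ] at hΛ
    have h1 := mul_sq_norm_le_trace hΓγ Λ
    have h2 : γ * (3 * ‖Λ‖) ^ 2 ≤ γ * r ^ 2 := by nlinarith [sq_nonneg ‖R⁻¹ * Baᵀ * Pu Λ - Kbar‖]
    have h3 := le_of_sq_le_sq (le_of_mul_le_mul_left h2 hγ0) hr.le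
    linarith
  obtain ⟨Λhat, hr', hcrit⟩ := exists_add_eq_zero_of_lipschitz hΓ hΓγ hc hr.le
    (fun Λ₁ Λ₂ h₁ h₂ => (hloc Λ₁ Λ₂ h₁ h₂).1) hγc hγr
  have hgrow : ∀ Λ, ‖Λ‖ ≤ r → Jcost Ba R Γ Kbar Pu Λhat + (γ - c) * ‖Λ - Λhat‖ ^ 2
      ≤ Jcost Ba R Γ Kbar Pu Λ := by
    intro Λ hΛ
    have h1 := (hloc Λ Λhat hΛ hr').2
    have h2 := mul_sq_norm_le_trace hΓγ (Λ - Λhat)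
    have h3 : ((Γ * Λhat)ᵀ * (Λ - Λhat)).trace + ((h Λhat)ᵀ * (Λ - Λhat)).trace = 0 := by
      rw [← Matrix.trace_add, ← Matrix.add_mul, ← Matrix.transpose_add, hcrit]
      simp
    rw [hJ, hJ, trace_quadratic_expansion hΓ.1.transpose_eq Λ Λhat]
    linarith
  have hnn : ∀ Λ : Matrix (Fin m_u) (Fin n) ℝ, 0 ≤ (γ - c) * ‖Λ‖ ^ 2 := fun Λ =>
    mul_nonneg (by linarith) (by positivity)
  have hmem : Λhat ∈ S0 A Bu Ba Q R Γ Kbar Pu :=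
    ⟨hex _ hr', by linarith [hgrow 0 (by simpa using hr.le), hnn (0 - Λhat)]⟩
  refine ⟨Λhat, hmem, ?_, fun Λ hΛ => by
    linarith [hgrow Λ (by linarith [hball Λ hΛ]), hnn (Λ - Λhat)]⟩
  simp only [frobNorm_eq_norm] at hLip ⊢
  rcases eq_or_ne Λhat 0 with h00 | h00
  · have hz : Λseq 0 = 0 := by
      have h1 := hgrow (Λseq 0) (by linarith [hball _ hΛ₀])
      have h2 := hΛ₀.2
      rw [h00, sub_zero] at h1
      have h3 : ‖Λseq 0‖ ^ 2 ≤ 0 := by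
        refine le_of_mul_le_mul_left (a := γ - c) ?_ (by linarith)
        linarith
      exact norm_eq_zero.1 (pow_eq_zero_iff two_ne_zero |>.1 (h3.antisymm (sq_nonneg _)))
    have hz' : ∀ i, Λseq i = 0 := by
      intro i
      induction i with
      | zero => exact hz
      | succ i ih =>
        rw [h00, Matrix.mul_zero, zero_add] at hcrit
        rw [hΛseq, ih, show Buᵀ * Pu 0 * Pim 0 = 0 from hcrit]
        simp
    simp [hz', h00]
  have hω' : ω < 4 / 3 := by
    have hz : (0 : Matrix (Fin m_u) (Fin n) ℝ) ∈ S0 A Bu Ba Q R Γ Kbar Pu := ⟨h0, le_rfl⟩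
    have h1 := hLip _ hmem _ hz
    refine stepSize_lt (D := h Λhat - h 0) hΓ hΓγ hγc hL h00 ?_ ?_ hω
    · simpa using (hloc Λhat 0 hr' (by simpa using hr.le)).1
    · rw [← smul_sub, Matrix.mul_zero, zero_add, sub_zero] at h1
      rwa [← add_sub_assoc]
  have hq : |1 - ω| + ω / 4 < 1 := by
    rcases abs_cases (1 - ω) with ⟨h1, h2⟩ | ⟨h1, h2⟩ <;> linarith
  have hdet : IsUnit Γ.det := hΓ.det_pos.ne'.isUnit
  have hhat : Γ⁻¹ * h Λhat = -Λhat := by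
    have : h Λhat = -(Γ * Λhat) := eq_neg_of_add_eq_zero_right hcrit
    rw [this, Matrix.mul_neg,
      Matrix.nonsing_inv_mul_cancel_left _ _ hdet]
  have h3 := hball _ hmem
  refine tendsto_of_norm_sub_succ_le (r := 2 * r / 3) (by positivity) hq ?_ ?_
  · linarith [norm_sub_le (Λseq 0) Λhat, hball _ hΛ₀]
  · intro i hi
    have hri : ‖Λseq i‖ ≤ r := by linarith [norm_le_norm_add_norm_sub' (Λseq i) Λhat]
    have h4 := (hloc _ _ hri hr').1
    have h5 := mul_norm_le_norm_mul hΓγ (Γ⁻¹ * (h (Λseq i) - h Λhat))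
    rw [Matrix.mul_nonsing_inv_cancel_left _ _ hdet] at h5
    have h6 : ‖Γ⁻¹ * (h (Λseq i) - h Λhat)‖ ≤ ‖Λseq i - Λhat‖ / 4 := by
      refine le_of_mul_le_mul_left (a := γ) ?_ hγ0
      have : 4 * c * ‖Λseq i - Λhat‖ ≤ γ * ‖Λseq i - Λhat‖ := by gcongr
      linarith
    have h7 : Λseq (i + 1) - Λhat
        = (1 - ω) • (Λseq i - Λhat) - ω • (Γ⁻¹ * (h (Λseq i) - h Λhat)) := by
      rw [hΛseq, Matrix.mul_sub, hhat]
      module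
    calc ‖Λseq (i + 1) - Λhat‖ ≤ |1 - ω| * ‖Λseq i - Λhat‖ + ω * (‖Λseq i - Λhat‖ / 4) := by
          rw [h7]
          refine (norm_sub_le _ _).trans ?_
          rw [norm_smul, norm_smul, Real.norm_eq_abs, Real.norm_eq_abs, abs_of_pos hω₀]
          gcongr
      _ = _ := by ring
end
end

section
/- Suppose A is Hurwitz and the column space of B_a is contained in the column space of B_u. Then: (i) for every L ∈ ℝ^{m_a×n} the stabilizing solution Z_a(L) of the perturbed minimizing ARE exists; and (ii) for every symmetric positive definite Γ ∈ ℝ^{m_a×m_a} and every N̄ ∈ ℝ^{m_u×n}, the function L ↦ ‖N_a(L) − N̄‖_F² + tr(LᵀΓL) attains a global minimum on ℝ^{m_a×n}, where N_a(L) = −M⁻¹B_uᵀZ_a(L). -/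
open Matrix Filter Topology

noncomputable section

variable {n m_u m_a : ℕ}

/-- `Z` is the stabilizing solution of the perturbed minimizing ARE for the
adversarial gain `L`. -/
def IsStabSolMin {n m_u m_a : ℕ}
    (A : Matrix (Fin n) (Fin n) ℝ) (Bu : Matrix (Fin n) (Fin m_u) ℝ)
    (Ba : Matrix (Fin n) (Fin m_a) ℝ) (Q : Matrix (Fin n) (Fin n) ℝ)
    (Mw : Matrix (Fin m_u) (Fin m_u) ℝ)
    (L : Matrix (Fin m_a) (Fin n) ℝ) (Z : Matrix (Fin n) (Fin n) ℝ) : Prop :=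
  Z.PosDef ∧
  (A + Ba * L)ᵀ * Z + Z * (A + Ba * L) + Q - Z * Bu * Mw⁻¹ * Buᵀ * Z = 0 ∧
  IsHurwitz (A + Ba * L - Bu * Mw⁻¹ * Buᵀ * Z)

lemma tendsto_pow_zero_of_spectrum {m : ℕ} (W : Matrix (Fin m) (Fin m) ℂ)
    (hW : ∀ z ∈ spectrum ℂ W, ‖z‖ < 1) : Tendsto (fun k => W ^ k) atTop (𝓝 0) := by
  rcases Nat.eq_zero_or_pos m with rfl | hm
  · exact tendsto_nhds_of_eventually_eq (Eventually.of_forall fun k => Subsingleton.elim _ _)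
  have : Nonempty (Fin m) := ⟨⟨0, hm⟩⟩
  let _ : NormedRing (Matrix (Fin m) (Fin m) ℂ) := Matrix.linftyOpNormedRing
  let _ : NormedAlgebra ℂ (Matrix (Fin m) (Fin m) ℂ) := Matrix.linftyOpNormedAlgebra
  have : CompleteSpace (Matrix (Fin m) (Fin m) ℂ) := FiniteDimensional.complete ℂ _
  have hr : spectralRadius ℂ W < (1 : NNReal) :=
    spectrum.spectralRadius_lt_of_forall_lt W fun z hz => by
      have := hW z hz
      rwa [← NNReal.coe_lt_coe, coe_nnnorm, NNReal.coe_one]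
  obtain ⟨r, hr1, hr2⟩ := ENNReal.lt_iff_exists_nnreal_btwn.1 hr
  have hr2 : r < 1 := by exact_mod_cast hr2
  have key : ∀ᶠ k : ℕ in atTop, ‖W ^ k‖ ≤ (r : ℝ) ^ k := by
    filter_upwards [(spectrum.pow_nnnorm_pow_one_div_tendsto_nhds_spectralRadius W).eventually_lt_const
      hr1, eventually_gt_atTop 0] with k hk hk0
    rw [one_div, ENNReal.rpow_inv_lt_iff (by positivity), ENNReal.rpow_natCast] at hk
    exact_mod_cast hk.le
  exact squeeze_zero_norm' key (tendsto_pow_atTop_nhds_zero_of_lt_one r.2 (by exact_mod_cast hr2))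

lemma norm_lt_one_of_cayley {m : ℕ} {A G : Matrix (Fin m) (Fin m) ℂ}
    (hA : ∀ μ ∈ spectrum ℂ A, μ.re < 0) (hG : (1 - A) * G = 1) :
    ∀ z ∈ spectrum ℂ ((1 + A) * G), ‖z‖ < 1 := by
  intro z hz
  by_contra! h
  refine spectrum.mem_iff.1 hz ?_
  have hGu : IsUnit G := IsUnit.of_mul_eq_one_right _ hG
  have e1 : algebraMap ℂ (Matrix (Fin m) (Fin m) ℂ) z - (1 + A) * G
      = ((z - 1) • 1 - (z + 1) • A) * G := by
    have : algebraMap ℂ (Matrix (Fin m) (Fin m) ℂ) z = z • ((1 - A) * G) := by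
      rw [hG, Algebra.algebraMap_eq_smul_one]
    rw [this, ← smul_mul_assoc, ← sub_mul]
    congr 1
    module
  rw [e1]
  refine IsUnit.mul ?_ hGu
  by_cases hz1 : z + 1 = 0
  · rw [hz1, zero_smul, sub_zero, ← Algebra.algebraMap_eq_smul_one]
    refine (IsUnit.mk0 (z - 1) fun h0 => ?_).map _
    have h2 : (2 : ℂ) = 0 := by linear_combination hz1 - h0
    norm_num at h2
  · have e2 : (z - 1) • 1 - (z + 1) • A
        = algebraMap ℂ (Matrix (Fin m) (Fin m) ℂ) (z + 1) * (algebraMap ℂ _ ((z - 1) / (z + 1)) - A) := by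
      rw [mul_sub, ← map_mul, mul_div_cancel₀ _ hz1, Algebra.algebraMap_eq_smul_one,
        Algebra.algebraMap_eq_smul_one, smul_mul_assoc, one_mul]
    rw [e2]
    refine IsUnit.mul ((IsUnit.mk0 _ hz1).map _) ?_
    by_contra hns
    have h3 := hA _ (spectrum.mem_iff.2 hns)
    have hsq : 1 ≤ Complex.normSq z := by
      rw [Complex.normSq_eq_norm_sq]; nlinarith [norm_nonneg z]
    have hpos : 0 < Complex.normSq (z + 1) := Complex.normSq_pos.2 hz1
    rw [Complex.div_re, ← add_div, div_lt_iff₀ hpos, zero_mul] at h3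
    rw [Complex.normSq_apply] at hsq
    simp only [Complex.sub_re, Complex.add_re, Complex.one_re, Complex.sub_im, Complex.add_im,
      Complex.one_im] at h3
    nlinarith

lemma IsHurwitz.exists_cayley {m : ℕ} {A : Matrix (Fin m) (Fin m) ℝ} (hA : IsHurwitz A) :
    ∃ G : Matrix (Fin m) (Fin m) ℝ, (1 - A) * G = 1 ∧
      Tendsto (fun k => ((1 + A) * G) ^ k) atTop (𝓝 0) := by
  set c : Matrix (Fin m) (Fin m) ℝ →+* Matrix (Fin m) (Fin m) ℂ := (algebraMap ℝ ℂ).mapMatrix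
  have hu : IsUnit (1 - A) := by
    have h1 : IsUnit (1 - c A) := by
      by_contra h
      have := hA 1 (spectrum.mem_iff.2 (by rwa [map_one]))
      norm_num at this
    rw [← map_one c, ← map_sub, Matrix.isUnit_iff_isUnit_det, ← RingHom.map_det] at h1
    rw [Matrix.isUnit_iff_isUnit_det]
    exact (isUnit_map_iff _ _).1 h1
  obtain ⟨G, hG⟩ := hu.exists_right_inv
  refine ⟨G, hG, ?_⟩
  have hGc : (1 - c A) * c G = 1 := by rw [← map_one c, ← map_sub, ← map_mul, hG]
  have ht := tendsto_pow_zero_of_spectrum _ (norm_lt_one_of_cayley (A := c A) hA hGc)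
  have hpow : ∀ k, ((1 + c A) * c G) ^ k = c (((1 + A) * G) ^ k) := fun k => by
    rw [map_pow, map_mul, map_add, map_one]
  simp_rw [hpow] at ht
  have hre : Continuous fun X : Matrix (Fin m) (Fin m) ℂ => X.map Complex.re :=
    continuous_id.matrix_map Complex.continuous_re
  convert (hre.tendsto 0).comp ht using 2
  · ext i j
    simp [c]
  · ext i j
    simp

lemma transpose_mul_mul_posSemidef {p q : ℕ} {C : Matrix (Fin p) (Fin p) ℝ} (hC : C.PosSemidef)
    (B : Matrix (Fin p) (Fin q) ℝ) : (Bᵀ * C * B).PosSemidef := by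
  simpa using hC.conjTranspose_mul_mul_same B

lemma Matrix.PosSemidef.transpose_eq {p : ℕ} {C : Matrix (Fin p) (Fin p) ℝ} (hC : C.PosSemidef) :
    Cᵀ = C := by
  simpa using hC.isHermitian.eq

lemma isClosed_posSemidef (p : ℕ) : IsClosed {C : Matrix (Fin p) (Fin p) ℝ | C.PosSemidef} := by
  simp only [Matrix.posSemidef_iff_dotProduct_mulVec, Matrix.IsHermitian, Set.ofPred_and,
    Set.ofPred_forall]
  refine (isClosed_eq (by fun_prop) continuous_id).inter
    (isClosed_iInter fun x => isClosed_le continuous_const ?_)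
  exact continuous_const.dotProduct (continuous_id.matrix_mulVec continuous_const)

lemma cayley_stein {m : ℕ} {A G Z C : Matrix (Fin m) (Fin m) ℝ} (hG : (1 - A) * G = 1)
    (h : Aᵀ * Z + Z * A + C = 0) :
    Z - ((1 + A) * G)ᵀ * Z * ((1 + A) * G) = Gᵀ * ((2 : ℝ) • C) * G := by
  have hZ : Z = ((1 - A) * G)ᵀ * Z * ((1 - A) * G) := by
    rw [hG, transpose_one, one_mul, mul_one]
  have hC : C = -(Aᵀ * Z + Z * A) := by rw [eq_neg_iff_add_eq_zero, add_comm, h]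
  conv_lhs => enter [1]; rw [hZ]
  rw [hC]
  simp only [transpose_mul, transpose_sub, transpose_add, transpose_one, two_smul]
  noncomm_ring

lemma tendsto_pow_conj_zero {m : ℕ} {W : Matrix (Fin m) (Fin m) ℝ}
    (hW : Tendsto (fun k => W ^ k) atTop (𝓝 0)) (Z : Matrix (Fin m) (Fin m) ℝ) :
    Tendsto (fun k => (W ^ k)ᵀ * Z * W ^ k) atTop (𝓝 0) := by
  have hc : Continuous fun X : Matrix (Fin m) (Fin m) ℝ => Xᵀ * Z * X := by fun_prop
  have h := (hc.tendsto 0).comp hW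
  rwa [mul_zero] at h

lemma IsHurwitz.posSemidef_of_lyapunov {m : ℕ} {A Z C : Matrix (Fin m) (Fin m) ℝ}
    (hA : IsHurwitz A) (hC : C.PosSemidef) (h : Aᵀ * Z + Z * A + C = 0) : Z.PosSemidef := by
  obtain ⟨G, hG, hW⟩ := hA.exists_cayley
  have hs := cayley_stein hG h
  set W := (1 + A) * G
  have hD : (Z - Wᵀ * Z * W).PosSemidef := by
    rw [hs]
    exact transpose_mul_mul_posSemidef (hC.smul (by norm_num)) G
  have hk : ∀ k : ℕ, (Z - (W ^ k)ᵀ * Z * W ^ k).PosSemidef := by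
    intro k
    induction k with
    | zero => simpa using Matrix.PosSemidef.zero
    | succ k ih =>
      have := ih.add (transpose_mul_mul_posSemidef hD (W ^ k))
      convert this using 1
      rw [pow_succ', transpose_mul]
      noncomm_ring
  have ht := (tendsto_const_nhds (x := Z)).sub (tendsto_pow_conj_zero hW Z)
  rw [sub_zero] at ht
  exact (isClosed_posSemidef m).mem_of_tendsto ht (Eventually.of_forall hk)

lemma IsHurwitz.eq_zero_of_lyapunov {m : ℕ} {A Z : Matrix (Fin m) (Fin m) ℝ}
    (hA : IsHurwitz A) (h : Aᵀ * Z + Z * A = 0) : Z = 0 := by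
  have h1 := hA.posSemidef_of_lyapunov Matrix.PosSemidef.zero (by rw [h, add_zero])
  have h2 := hA.posSemidef_of_lyapunov (Z := -Z) Matrix.PosSemidef.zero
    (by rw [add_zero, mul_neg, neg_mul, ← neg_add, h, neg_zero])
  have h3 := h2.trace_nonneg
  rw [trace_neg] at h3
  exact h1.trace_eq_zero_iff.1 (le_antisymm (by linarith) h1.trace_nonneg)

/-- The solution operator of the Lyapunov equation. -/
lemma IsHurwitz.exists_lyapunov_solution {m : ℕ} {A : Matrix (Fin m) (Fin m) ℝ}
    (hA : IsHurwitz A) :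
    ∃ T : Matrix (Fin m) (Fin m) ℝ →ₗ[ℝ] Matrix (Fin m) (Fin m) ℝ,
      ∀ C, Aᵀ * T C + T C * A + C = 0 := by
  let Φ : Matrix (Fin m) (Fin m) ℝ →ₗ[ℝ] Matrix (Fin m) (Fin m) ℝ :=
    LinearMap.mulLeft ℝ Aᵀ + LinearMap.mulRight ℝ A
  have hinj : Function.Injective Φ := by
    rw [← LinearMap.ker_eq_bot, LinearMap.ker_eq_bot']
    exact fun Z hZ => hA.eq_zero_of_lyapunov hZ
  let e := LinearEquiv.ofInjectiveEndo Φ hinj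
  refine ⟨-e.symm.toLinearMap, fun C => ?_⟩
  have h : Φ (e.symm C) = C := e.apply_symm_apply C
  have h' : Aᵀ * e.symm C + e.symm C * A = C := h
  simp only [LinearMap.neg_apply, LinearEquiv.coe_coe, mul_neg, neg_mul]
  rw [← neg_add, h', neg_add_cancel]

lemma isHurwitz_of_lyapunov {m : ℕ} {A Z C : Matrix (Fin m) (Fin m) ℝ} (hZ : Z.PosSemidef)
    (hC : C.PosDef) (h : Aᵀ * Z + Z * A + C = 0) : IsHurwitz A := by
  intro μ hμ
  by_contra! hre
  rw [← Matrix.spectrum_toLin', ← Module.End.hasEigenvalue_iff_mem_spectrum] at hμ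
  obtain ⟨v, hv⟩ := hμ.exists_hasEigenvector
  have hv1 : A.map (algebraMap ℝ ℂ) *ᵥ v = μ • v := by simpa using hv.apply_eq_smul
  set x : Fin m → ℝ := fun i => (v i).re
  set y : Fin m → ℝ := fun i => (v i).im
  have hx : A *ᵥ x = μ.re • x - μ.im • y := by
    ext i
    simpa [mulVec, dotProduct, x, y] using congrArg Complex.re (congrFun hv1 i)
  have hy : A *ᵥ y = μ.im • x + μ.re • y := by
    ext i
    simpa [mulVec, dotProduct, x, y, add_comm] using congrArg Complex.im (congrFun hv1 i)
  have hq : ∀ w, 2 * (w ⬝ᵥ Z *ᵥ (A *ᵥ w)) + w ⬝ᵥ C *ᵥ w = 0 := by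
    intro w
    have h0 : w ⬝ᵥ (Aᵀ * Z + Z * A + C) *ᵥ w = 0 := by rw [h, zero_mulVec, dotProduct_zero]
    have h1 : w ⬝ᵥ (Aᵀ * Z) *ᵥ w = w ⬝ᵥ Z *ᵥ (A *ᵥ w) := by
      rw [← mulVec_mulVec, dotProduct_mulVec, vecMul_transpose, dotProduct_mulVec, ← mulVec_transpose,
        PosSemidef.transpose_eq hZ, dotProduct_comm, dotProduct_mulVec, ← mulVec_transpose]
    rw [add_mulVec, add_mulVec, dotProduct_add, dotProduct_add, h1, ← mulVec_mulVec] at h0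
    linarith
  have hsym : y ⬝ᵥ Z *ᵥ x = x ⬝ᵥ Z *ᵥ y := by
    rw [dotProduct_mulVec, ← mulVec_transpose, PosSemidef.transpose_eq hZ, dotProduct_comm]
  have hqx := hq x
  have hqy := hq y
  rw [hx, mulVec_sub, mulVec_smul, mulVec_smul, dotProduct_sub, dotProduct_smul,
    dotProduct_smul, smul_eq_mul, smul_eq_mul] at hqx
  rw [hy, mulVec_add, mulVec_smul, mulVec_smul, dotProduct_add, dotProduct_smul,
    dotProduct_smul, smul_eq_mul, smul_eq_mul, hsym] at hqy
  have hzx : 0 ≤ x ⬝ᵥ Z *ᵥ x := by simpa using hZ.dotProduct_mulVec_nonneg x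
  have hzy : 0 ≤ y ⬝ᵥ Z *ᵥ y := by simpa using hZ.dotProduct_mulVec_nonneg y
  have hcx : 0 ≤ x ⬝ᵥ C *ᵥ x := by simpa using hC.posSemidef.dotProduct_mulVec_nonneg x
  have hcy : 0 ≤ y ⬝ᵥ C *ᵥ y := by simpa using hC.posSemidef.dotProduct_mulVec_nonneg y
  have hsum : x ⬝ᵥ C *ᵥ x + y ⬝ᵥ C *ᵥ y ≤ 0 := by
    nlinarith [mul_nonneg hre hzx, mul_nonneg hre hzy]
  have hx0 : x = 0 := by
    by_contra hne
    have : 0 < x ⬝ᵥ C *ᵥ x := by simpa using hC.dotProduct_mulVec_pos hne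
    linarith
  have hy0 : y = 0 := by
    by_contra hne
    have : 0 < y ⬝ᵥ C *ᵥ y := by simpa using hC.dotProduct_mulVec_pos hne
    linarith
  exact hv.2 (funext fun i => Complex.ext (congrFun hx0 i) (congrFun hy0 i))

/-- The residual of the algebraic Riccati equation `Fᵀ Z + Z F + Q - Z S Z = 0`. -/
def riccatiResidual {m : ℕ} (F S Q Z : Matrix (Fin m) (Fin m) ℝ) : Matrix (Fin m) (Fin m) ℝ :=
  Fᵀ * Z + Z * F + Q - Z * S * Z

section Riccati

variable {m : ℕ} {F S Q Y Z : Matrix (Fin m) (Fin m) ℝ}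

lemma mul_mul_posSemidef (hS : S.PosSemidef) (hZ : Zᵀ = Z) : (Z * S * Z).PosSemidef := by
  simpa [hZ] using transpose_mul_mul_posSemidef hS Z

lemma transpose_closedLoop (hS : S.PosSemidef) (hZ : Z.PosSemidef) :
    (F - S * Z)ᵀ = Fᵀ - Z * S := by
  rw [transpose_sub, transpose_mul, PosSemidef.transpose_eq hZ, PosSemidef.transpose_eq hS]

lemma isHurwitz_of_riccatiResidual_nonpos (hS : S.PosSemidef) (hQ : Q.PosDef)
    (hZ : Z.PosSemidef) (h : (-riccatiResidual F S Q Z).PosSemidef) : IsHurwitz (F - S * Z) := by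
  refine isHurwitz_of_lyapunov hZ (hQ.add_posSemidef
    ((mul_mul_posSemidef hS (PosSemidef.transpose_eq hZ)).add h)) ?_
  rw [transpose_closedLoop hS hZ, riccatiResidual]
  noncomm_ring

/-- A solution of the Riccati equation lies below every supersolution. -/
lemma posSemidef_sub_of_riccatiResidual (hS : S.PosSemidef) (hQ : Q.PosDef)
    (hZ : Z.PosSemidef) (hZ0 : riccatiResidual F S Q Z = 0)
    (hY : Y.PosSemidef) (h : (-riccatiResidual F S Q Y).PosSemidef) : (Y - Z).PosSemidef := by
  have hT : (Y - Z)ᵀ = Y - Z := by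
    rw [transpose_sub, PosSemidef.transpose_eq hZ, PosSemidef.transpose_eq hY]
  refine (isHurwitz_of_riccatiResidual_nonpos hS hQ hY h).posSemidef_of_lyapunov
    (h.add (mul_mul_posSemidef hS hT)) ?_
  have e : -riccatiResidual F S Q Y = -riccatiResidual F S Q Y + riccatiResidual F S Q Z := by
    rw [hZ0, add_zero]
  rw [e, transpose_closedLoop hS hY, riccatiResidual, riccatiResidual]
  noncomm_ring

/-- One Newton step below a supersolution yields another supersolution. -/
lemma exists_newton_step (hS : S.PosSemidef) (hQ : Q.PosDef)
    (hY : Y.PosSemidef) (h : (-riccatiResidual F S Q Y).PosSemidef) :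
    ∃ Z : Matrix (Fin m) (Fin m) ℝ, Z.PosSemidef ∧ (Y - Z).PosSemidef ∧
      riccatiResidual F S Q Z = -((Z - Y) * S * (Z - Y)) := by
  have hH := isHurwitz_of_riccatiResidual_nonpos hS hQ hY h
  obtain ⟨T, hT⟩ := hH.exists_lyapunov_solution
  have hZ := hT (Q + Y * S * Y)
  set Z := T (Q + Y * S * Y)
  refine ⟨Z, hH.posSemidef_of_lyapunov (hQ.posSemidef.add
    (mul_mul_posSemidef hS (PosSemidef.transpose_eq hY))) hZ, hH.posSemidef_of_lyapunov h ?_, ?_⟩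
  · rw [← neg_eq_zero, ← hZ, transpose_closedLoop hS hY, riccatiResidual]
    noncomm_ring
  · rw [← add_zero (-_), ← hZ, transpose_closedLoop hS hY, riccatiResidual]
    noncomm_ring

lemma posDef_of_riccatiResidual_eq_zero (hQ : Q.PosDef)
    (hZ : Z.PosSemidef) (h : riccatiResidual F S Q Z = 0) : Z.PosDef := by
  refine .of_dotProduct_mulVec_pos hZ.1 fun x hx => ?_
  refine lt_of_le_of_ne (hZ.dotProduct_mulVec_nonneg x) fun h0 => ?_
  have hzx : Z *ᵥ x = 0 := (hZ.dotProduct_mulVec_zero_iff x).1 h0.symm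
  have hxz : x ᵥ* Z = 0 := by rw [← mulVec_transpose, PosSemidef.transpose_eq hZ, hzx]
  have h1 : x ⬝ᵥ riccatiResidual F S Q Z *ᵥ x = 0 := by rw [h, zero_mulVec, dotProduct_zero]
  have h2 : 0 < x ⬝ᵥ Q *ᵥ x := by simpa using hQ.dotProduct_mulVec_pos hx
  have h3 : x ⬝ᵥ riccatiResidual F S Q Z *ᵥ x = x ⬝ᵥ Q *ᵥ x := by
    rw [riccatiResidual, sub_mulVec, add_mulVec, add_mulVec, ← mulVec_mulVec, ← mulVec_mulVec,
      ← mulVec_mulVec, hzx, mulVec_zero, mulVec_zero, sub_zero, zero_add, dotProduct_add,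
      dotProduct_mulVec x Z, hxz, zero_dotProduct, zero_add]
  linarith

end Riccati

/-- The matrices all of whose entries are bounded by `c` in absolute value. -/
def entryBox (p q : ℕ) (c : ℝ) : Set (Matrix (Fin p) (Fin q) ℝ) :=
  {X | ∀ i j, X i j ∈ Set.Icc (-c) c}

lemma isClosed_entryBox (p q : ℕ) (c : ℝ) : IsClosed (entryBox p q c) := by
  simp only [entryBox, Set.ofPred_forall]
  exact isClosed_iInter fun i => isClosed_iInter fun j =>
    isClosed_Icc.preimage (continuous_id.matrix_elem i j)

lemma isCompact_entryBox (p q : ℕ) (c : ℝ) : IsCompact (entryBox p q c) := by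
  have h : IsCompact (Set.univ.pi fun _ : Fin p => Set.univ.pi fun _ : Fin q => Set.Icc (-c) c) :=
    isCompact_univ_pi fun _ => isCompact_univ_pi fun _ => isCompact_Icc
  exact h.of_isClosed_subset (isClosed_entryBox p q c) fun X hX i _ j _ => hX i j

lemma mem_entryBox_of_posSemidef {p : ℕ} {Z : Matrix (Fin p) (Fin p) ℝ} {c : ℝ}
    (hZ : Z.PosSemidef) (hc : Z.trace ≤ c) : Z ∈ entryBox p p c := by
  intro i j
  have hd : ∀ k, Z k k ≤ c := fun k =>
    (Finset.single_le_sum (f := fun k => Z k k) (fun l _ => hZ.diag_nonneg)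
      (Finset.mem_univ k)).trans hc
  have hs : Z j i = Z i j := by
    conv_lhs => rw [← PosSemidef.transpose_eq hZ, transpose_apply]
  have h1 := hZ.dotProduct_mulVec_nonneg (Pi.single i 1 + Pi.single j 1)
  have h2 := hZ.dotProduct_mulVec_nonneg (Pi.single i 1 - Pi.single j 1)
  simp [mulVec_add, mulVec_sub] at h1 h2
  constructor <;> linarith [hd i, hd j]

lemma mem_entryBox_of_trace {p q : ℕ} {X : Matrix (Fin p) (Fin q) ℝ} {c : ℝ}
    (h : (Xᵀ * X).trace ≤ c) : X ∈ entryBox p q (Real.sqrt c) := by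
  intro i j
  rw [Set.mem_Icc, ← abs_le]
  apply Real.abs_le_sqrt
  refine le_trans ?_ h
  rw [trace]
  refine le_trans ?_ (Finset.single_le_sum (fun k _ => ?_) (Finset.mem_univ j))
  · rw [diag_apply, mul_apply, sq]
    exact Finset.single_le_sum (f := fun k => Xᵀ j k * X k j) (fun k _ => mul_self_nonneg (X k j))
      (Finset.mem_univ i)
  · rw [diag_apply, mul_apply]
    exact Finset.sum_nonneg fun l _ => mul_self_nonneg (X l k)

lemma exists_compact_of_trace_le {p q : ℕ} {Γ : Matrix (Fin p) (Fin p) ℝ} (hΓ : Γ.PosDef)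
    (c : ℝ) : ∃ K : Set (Matrix (Fin p) (Fin q) ℝ), IsCompact K ∧
      ∀ L, (Lᵀ * Γ * L).trace ≤ c → L ∈ K := by
  open scoped MatrixOrder in
  obtain ⟨R, hR⟩ := CStarAlgebra.nonneg_iff_eq_star_mul_self.mp hΓ.posSemidef.nonneg
  have hR' : Γ = Rᵀ * R := by simpa [star_eq_conjTranspose] using hR
  have hu : IsUnit R := IsUnit.of_mul_eq_one_right (Γ⁻¹ * Rᵀ) (by
    rw [mul_assoc, ← hR', nonsing_inv_mul _ ((isUnit_iff_isUnit_det _).1 hΓ.isUnit)])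
  refine ⟨(fun X => R⁻¹ * X) '' entryBox p q (Real.sqrt c),
    (isCompact_entryBox p q _).image (by fun_prop), fun L hL => ⟨R * L, ?_, ?_⟩⟩
  · apply mem_entryBox_of_trace
    rwa [transpose_mul, ← Matrix.mul_assoc, Matrix.mul_assoc Lᵀ, ← hR']
  · exact nonsing_inv_mul_cancel_left _ _ ((isUnit_iff_isUnit_det _).1 hu)

lemma continuous_riccatiResidual {m : ℕ} {X : Type*} [TopologicalSpace X]
    {F Z : X → Matrix (Fin m) (Fin m) ℝ} (S Q : Matrix (Fin m) (Fin m) ℝ)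
    (hF : Continuous F) (hZ : Continuous Z) :
    Continuous fun x => riccatiResidual (F x) S Q (Z x) := by
  unfold riccatiResidual
  fun_prop

lemma exists_riccati_solution {m : ℕ} {F S Q Y : Matrix (Fin m) (Fin m) ℝ}
    (hS : S.PosSemidef) (hQ : Q.PosDef) (hY : Y.PosSemidef)
    (h : (-riccatiResidual F S Q Y).PosSemidef) :
    ∃ Z : Matrix (Fin m) (Fin m) ℝ, Z.PosSemidef ∧ riccatiResidual F S Q Z = 0 := by
  let K : Set (Matrix (Fin m) (Fin m) ℝ) :=
    {Z | Z.PosSemidef ∧ (-riccatiResidual F S Q Z).PosSemidef ∧ Z.trace ≤ Y.trace}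
  have hK : IsCompact K := by
    refine (isCompact_entryBox m m Y.trace).of_isClosed_subset ?_
      fun Z hZ => mem_entryBox_of_posSemidef hZ.1 hZ.2.2
    exact (isClosed_posSemidef m).inter (((isClosed_posSemidef m).preimage
      (continuous_riccatiResidual S Q continuous_const continuous_id).neg).inter
      (isClosed_le continuous_id.matrix_trace continuous_const))
  obtain ⟨X, hX, hmin⟩ := hK.exists_isMinOn ⟨Y, hY, h, le_rfl⟩
    (f := Matrix.trace) continuous_id.matrix_trace.continuousOn
  obtain ⟨Z, hZ, hXZ, hres⟩ := exists_newton_step hS hQ hX.1 hX.2.1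
  have hle : Z.trace ≤ X.trace := by
    have := hXZ.trace_nonneg
    rw [trace_sub] at this
    linarith
  have hZK : Z ∈ K := by
    refine ⟨hZ, ?_, hle.trans hX.2.2⟩
    rw [hres, neg_neg]
    refine mul_mul_posSemidef hS ?_
    rw [transpose_sub, PosSemidef.transpose_eq hZ, PosSemidef.transpose_eq hX.1]
  have hge : X.trace ≤ Z.trace := hmin hZK
  have h0 : X - Z = 0 := hXZ.trace_eq_zero_iff.1 (by rw [trace_sub]; linarith)
  refine ⟨Z, hZ, ?_⟩
  rw [hres, ← neg_sub X Z, h0]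
  simp

section PerturbedRiccati

variable {A : Matrix (Fin n) (Fin n) ℝ} {Bu : Matrix (Fin n) (Fin m_u) ℝ}
  {Ba : Matrix (Fin n) (Fin m_a) ℝ} {Q : Matrix (Fin n) (Fin n) ℝ}
  {Mw : Matrix (Fin m_u) (Fin m_u) ℝ}

lemma posSemidef_control (hMw : Mw.PosDef) : (Bu * Mw⁻¹ * Buᵀ).PosSemidef := by
  simpa using hMw.inv.posSemidef.mul_mul_conjTranspose_same Bu

lemma isStabSolMin_iff (hQ : Q.PosDef) (hMw : Mw.PosDef) (L : Matrix (Fin m_a) (Fin n) ℝ)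
    (Z : Matrix (Fin n) (Fin n) ℝ) :
    IsStabSolMin A Bu Ba Q Mw L Z ↔
      Z.PosSemidef ∧ riccatiResidual (A + Ba * L) (Bu * Mw⁻¹ * Buᵀ) Q Z = 0 := by
  have e : riccatiResidual (A + Ba * L) (Bu * Mw⁻¹ * Buᵀ) Q Z =
      (A + Ba * L)ᵀ * Z + Z * (A + Ba * L) + Q - Z * Bu * Mw⁻¹ * Buᵀ * Z := by
    simp only [riccatiResidual, Matrix.mul_assoc]
  refine ⟨fun h => ⟨h.1.posSemidef, e.trans h.2.1⟩, fun h =>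
    ⟨posDef_of_riccatiResidual_eq_zero hQ h.1 h.2, e.symm.trans h.2, ?_⟩⟩
  refine isHurwitz_of_riccatiResidual_nonpos (posSemidef_control hMw) hQ h.1 ?_
  rw [h.2, neg_zero]
  exact Matrix.PosSemidef.zero

lemma exists_eq_mul_of_range_le
    (hRan : LinearMap.range Ba.mulVecLin ≤ LinearMap.range Bu.mulVecLin) :
    ∃ T : Matrix (Fin m_u) (Fin m_a) ℝ, Ba = Bu * T := by
  have h : ∀ j, ∃ t, Bu *ᵥ t = Ba.col j := fun j => by
    obtain ⟨t, ht⟩ := hRan ⟨Pi.single j 1, rfl⟩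
    exact ⟨t, by simpa using ht⟩
  choose t ht using h
  refine ⟨(Matrix.of t)ᵀ, ?_⟩
  ext i j
  exact (congrFun (ht j) i).symm

/-- The cost of cancelling the perturbation `Bu * K` is a supersolution. -/
lemma riccatiResidual_of_lyapunov (hMw : Mw.PosDef) {K : Matrix (Fin m_u) (Fin n) ℝ}
    {Z : Matrix (Fin n) (Fin n) ℝ} (hZ : Z.PosSemidef)
    (h : Aᵀ * Z + Z * A + (Q + Kᵀ * Mw * K) = 0) :
    (-riccatiResidual (A + Bu * K) (Bu * Mw⁻¹ * Buᵀ) Q Z).PosSemidef := by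
  have hp := transpose_mul_mul_posSemidef hMw.inv.posSemidef (Mw * K - Buᵀ * Z)
  convert hp using 1
  have hdet : IsUnit Mw.det := (isUnit_iff_isUnit_det _).1 hMw.isUnit
  have e1 : Kᵀ * Mw * Mw⁻¹ = Kᵀ := mul_nonsing_inv_cancel_right _ _ hdet
  have e2 : Mw⁻¹ * (Mw * K) = K := nonsing_inv_mul_cancel_left _ _ hdet
  have e3 : (Mw * K - Buᵀ * Z)ᵀ * Mw⁻¹ * (Mw * K - Buᵀ * Z) =
      Kᵀ * Mw * K - Kᵀ * Buᵀ * Z - Z * Bu * K + Z * Bu * Mw⁻¹ * Buᵀ * Z := by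
    rw [transpose_sub, transpose_mul, transpose_mul, PosSemidef.transpose_eq hZ,
      PosSemidef.transpose_eq hMw.posSemidef, transpose_transpose, Matrix.sub_mul, e1,
      Matrix.mul_sub, Matrix.sub_mul, Matrix.sub_mul, Matrix.mul_assoc (Z * Bu), e2]
    simp only [Matrix.mul_assoc]
    abel
  have e4 : Q = -(Aᵀ * Z + Z * A + Kᵀ * Mw * K) := by
    rw [eq_neg_iff_add_eq_zero, ← h]
    abel
  rw [e3, riccatiResidual, transpose_add, transpose_mul, Matrix.add_mul, Matrix.mul_add]
  conv_lhs => rw [e4]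
  simp only [Matrix.mul_assoc]
  abel

end PerturbedRiccati

/-- Section VI-C: the dual (minimizing) deception problem is
always well posed when `A` is Hurwitz and `Ran(Ba) ⊆ Ran(Bu)`. -/
theorem stmt13
    (A : Matrix (Fin n) (Fin n) ℝ) (Bu : Matrix (Fin n) (Fin m_u) ℝ)
    (Ba : Matrix (Fin n) (Fin m_a) ℝ)
    (Q : Matrix (Fin n) (Fin n) ℝ) (Mw : Matrix (Fin m_u) (Fin m_u) ℝ)
    (hQ : Q.PosDef) (hMw : Mw.PosDef)
    (hA : IsHurwitz A)
    (hRan : LinearMap.range Ba.mulVecLin ≤ LinearMap.range Bu.mulVecLin) :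
    (∀ L : Matrix (Fin m_a) (Fin n) ℝ, ∃ Z, IsStabSolMin A Bu Ba Q Mw L Z) ∧
    (∀ Γ : Matrix (Fin m_a) (Fin m_a) ℝ, Γ.PosDef →
      ∀ Nbar : Matrix (Fin m_u) (Fin n) ℝ,
        ∃ Ls Zs, IsStabSolMin A Bu Ba Q Mw Ls Zs ∧
          ∀ L Z, IsStabSolMin A Bu Ba Q Mw L Z →
            frobNorm (-(Mw⁻¹ * Buᵀ * Zs) - Nbar) ^ 2 + Matrix.trace (Lsᵀ * Γ * Ls) ≤
              frobNorm (-(Mw⁻¹ * Buᵀ * Z) - Nbar) ^ 2 + Matrix.trace (Lᵀ * Γ * L)) := by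
  obtain ⟨T, rfl⟩ := exists_eq_mul_of_range_le hRan
  have hS : (Bu * Mw⁻¹ * Buᵀ).PosSemidef := posSemidef_control hMw
  obtain ⟨Λ, hΛ⟩ := hA.exists_lyapunov_solution
  let Y : Matrix (Fin m_a) (Fin n) ℝ → Matrix (Fin n) (Fin n) ℝ :=
    fun L => Λ (Q + (T * L)ᵀ * Mw * (T * L))
  have hY : ∀ L, (Y L).PosSemidef := fun L => hA.posSemidef_of_lyapunov
    (hQ.posSemidef.add (transpose_mul_mul_posSemidef hMw.posSemidef (T * L))) (hΛ _)
  have hYres : ∀ L,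
      (-riccatiResidual (A + Bu * T * L) (Bu * Mw⁻¹ * Buᵀ) Q (Y L)).PosSemidef := fun L => by
    rw [Matrix.mul_assoc Bu]
    exact riccatiResidual_of_lyapunov hMw (hY L) (hΛ _)
  have hYc : Continuous Y := Λ.continuous_of_finiteDimensional.comp (by fun_prop)
  have hex : ∀ L : Matrix (Fin m_a) (Fin n) ℝ, ∃ Z, IsStabSolMin A Bu (Bu * T) Q Mw L Z :=
    fun L => by
      simp only [isStabSolMin_iff hQ hMw]
      exact exists_riccati_solution hS hQ (hY L) (hYres L)
  refine ⟨hex, fun Γ hΓ Nbar => ?_⟩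
  let J : Matrix (Fin m_a) (Fin n) ℝ × Matrix (Fin n) (Fin n) ℝ → ℝ := fun p =>
    frobNorm (-(Mw⁻¹ * Buᵀ * p.2) - Nbar) ^ 2 + Matrix.trace (p.1ᵀ * Γ * p.1)
  have hJ : Continuous J := by
    unfold J frobNorm
    fun_prop
  obtain ⟨Z₀, hZ₀⟩ := hex 0
  obtain ⟨K, hK, hKmem⟩ := exists_compact_of_trace_le (q := n) hΓ (J (0, Z₀))
  obtain ⟨b, hb⟩ := (hK.image hYc.matrix_trace).bddAbove
  let G : Set (Matrix (Fin m_a) (Fin n) ℝ × Matrix (Fin n) (Fin n) ℝ) :=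
    {p | IsStabSolMin A Bu (Bu * T) Q Mw p.1 p.2 ∧ J p ≤ J (0, Z₀)}
  have hG : IsCompact G := by
    refine (hK.prod (isCompact_entryBox n n b)).of_isClosed_subset ?_ ?_
    · simp only [G, isStabSolMin_iff hQ hMw]
      exact (((isClosed_posSemidef n).preimage continuous_snd).inter
        (isClosed_eq (continuous_riccatiResidual _ _ (by fun_prop) continuous_snd)
          continuous_const)).inter (isClosed_le hJ continuous_const)
    · rintro ⟨L, Z⟩ ⟨hZ, hle⟩
      rw [isStabSolMin_iff hQ hMw] at hZ
      have hL : L ∈ K := hKmem L ((le_add_of_nonneg_left (sq_nonneg _)).trans hle)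
      refine ⟨hL, mem_entryBox_of_posSemidef hZ.1 (le_trans ?_ (hb ⟨L, hL, rfl⟩))⟩
      have := (posSemidef_sub_of_riccatiResidual hS hQ hZ.1 hZ.2 (hY L) (hYres L)).trace_nonneg
      rwa [trace_sub, sub_nonneg] at this
  obtain ⟨⟨Ls, Zs⟩, hmem, hmin⟩ := hG.exists_isMinOn ⟨(0, Z₀), hZ₀, le_rfl⟩ hJ.continuousOn
  refine ⟨Ls, Zs, hmem.1, fun L Z hZ => ?_⟩
  change J (Ls, Zs) ≤ J (L, Z)
  by_cases hle : J (L, Z) ≤ J (0, Z₀)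
  · exact isMinOn_iff.1 hmin (L, Z) ⟨hZ, hle⟩
  · exact hmem.2.trans (le_of_not_ge hle)
end
end

section
/- Suppose A is Hurwitz and the column space of B_a is contained in the column space of B_u. Then the learned attack gain can be suppressed arbitrarily: for every ε > 0 there exists Λ ∈ ℝ^{m_u×n} such that the stabilizing solution P_u(Λ) of the spoofed ARE exists and ‖R⁻¹B_aᵀP_u(Λ)‖_F < ε. -/
open Matrix Filter Topology

noncomputable section

variable {n m_u m_a : ℕ}

/-- Spectrum of a complex matrix in terms of eigenvectors. -/
theorem mem_spectrum_iff_exists_mulVec {N : ℕ} {M : Matrix (Fin N) (Fin N) ℂ} {μ : ℂ} :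
    μ ∈ spectrum ℂ M ↔ ∃ v ≠ 0, M *ᵥ v = μ • v := by
  rw [spectrum.mem_iff, isUnit_iff_isUnit_det, isUnit_iff_ne_zero, not_not,
    ← exists_mulVec_eq_zero_iff]
  simp only [sub_mulVec, sub_eq_zero, Algebra.algebraMap_eq_smul_one, smul_mulVec, one_mulVec,
    eq_comm]

/-- Lyapunov's criterion: a strict Lyapunov inequality with `P > 0` forces `M` to be Hurwitz. -/
theorem isHurwitz_of_lyapunov_s15 {N : ℕ} {M P : Matrix (Fin N) (Fin N) ℝ} (hP : P.PosDef)
    (hM : (-(Mᵀ * P + P * M)).PosDef) : IsHurwitz M := by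
  intro μ hμ
  obtain ⟨v, hv0, hv⟩ := mem_spectrum_iff_exists_mulVec.1 hμ
  set x : Fin N → ℝ := fun i => (v i).re with hx
  set y : Fin N → ℝ := fun i => (v i).im with hy
  have hMx : M *ᵥ x = μ.re • x - μ.im • y := by
    ext i
    have := congrArg Complex.re (congrFun hv i)
    simpa [mulVec, dotProduct, hx, hy] using this
  have hMy : M *ᵥ y = μ.re • y + μ.im • x := by
    ext i
    have := congrArg Complex.im (congrFun hv i)
    simpa [mulVec, dotProduct, hx, hy] using this
  have hxy : x ≠ 0 ∨ y ≠ 0 := by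
    by_contra! h
    refine hv0 (funext fun i => Complex.ext ?_ ?_)
    · exact congrFun h.1 i
    · exact congrFun h.2 i
  have hPt : Pᵀ = P := hP.isHermitian
  have symm : ∀ a b : Fin N → ℝ, a ⬝ᵥ P *ᵥ b = b ⬝ᵥ P *ᵥ a := fun a b => by
    rw [dotProduct_mulVec, ← mulVec_transpose, hPt, dotProduct_comm]
  have form : ∀ a : Fin N → ℝ,
      a ⬝ᵥ (-(Mᵀ * P + P * M)) *ᵥ a = -(2 * (a ⬝ᵥ P *ᵥ (M *ᵥ a))) := fun a => by
    have : a ⬝ᵥ Mᵀ *ᵥ (P *ᵥ a) = a ⬝ᵥ P *ᵥ (M *ᵥ a) := by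
      rw [symm, dotProduct_mulVec, vecMul_transpose]
    rw [neg_mulVec, dotProduct_neg, add_mulVec, dotProduct_add, ← mulVec_mulVec, ← mulVec_mulVec,
      this, two_mul]
  have key : x ⬝ᵥ (-(Mᵀ * P + P * M)) *ᵥ x + y ⬝ᵥ (-(Mᵀ * P + P * M)) *ᵥ y
      = -(2 * μ.re * (x ⬝ᵥ P *ᵥ x + y ⬝ᵥ P *ᵥ y)) := by
    rw [form, form, hMx, hMy]
    simp only [mulVec_sub, mulVec_add, mulVec_smul, dotProduct_sub, dotProduct_add,
      dotProduct_smul, smul_eq_mul, symm y x]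
    ring
  have pos : ∀ {L : Matrix (Fin N) (Fin N) ℝ}, L.PosDef →
      0 < x ⬝ᵥ L *ᵥ x + y ⬝ᵥ L *ᵥ y := fun {L} hL => by
    have h1 : 0 ≤ x ⬝ᵥ L *ᵥ x := by simpa using hL.posSemidef.dotProduct_mulVec_nonneg x
    have h2 : 0 ≤ y ⬝ᵥ L *ᵥ y := by simpa using hL.posSemidef.dotProduct_mulVec_nonneg y
    rcases hxy with h | h
    · have : 0 < x ⬝ᵥ L *ᵥ x := by simpa using hL.dotProduct_mulVec_pos h
      linarith
    · have : 0 < y ⬝ᵥ L *ᵥ y := by simpa using hL.dotProduct_mulVec_pos h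
      linarith
  have h1 := pos hP
  have h2 := pos hM
  rw [key] at h2
  by_contra! h
  nlinarith [mul_nonneg h h1.le]

/-- Large multiples of a positive definite matrix dominate any symmetric matrix. -/
theorem exists_posDef_smul_sub {N : ℕ} {Q : Matrix (Fin N) (Fin N) ℝ} (hQ : Q.PosDef)
    {P : Matrix (Fin N) (Fin N) ℝ} (hP : P.IsHermitian) :
    ∃ T : ℝ, ∀ t, T < t → (t • Q - P).PosDef := by
  have pos : ∀ x : Fin N → ℝ, x ≠ 0 → 0 < x ⬝ᵥ Q *ᵥ x := fun x hx => by
    simpa using hQ.dotProduct_mulVec_pos hx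
  have cont : ContinuousOn (fun x : Fin N → ℝ => (x ⬝ᵥ P *ᵥ x) / (x ⬝ᵥ Q *ᵥ x))
      (Metric.sphere 0 1) := by
    refine ContinuousOn.div (by fun_prop) (by fun_prop) fun x hx => (pos x ?_).ne'
    rintro rfl
    simp at hx
  obtain ⟨T, hT⟩ := (isCompact_sphere (0 : Fin N → ℝ) 1).bddAbove_image cont
  refine ⟨T, fun t ht => PosDef.of_dotProduct_mulVec_pos ?_ fun x hx => ?_⟩
  · exact (hQ.isHermitian.smul (IsSelfAdjoint.all t)).sub hP
  · have hnx : ‖x‖ ≠ 0 := norm_ne_zero_iff.2 hx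
    have h := hT ⟨‖x‖⁻¹ • x, by simp [norm_smul, hnx], rfl⟩
    have hq := pos x hx
    simp only [mulVec_smul, dotProduct_smul, smul_dotProduct, smul_eq_mul] at h
    rw [← mul_assoc, ← mul_assoc, mul_div_mul_left _ _ (by positivity), div_le_iff₀ hq] at h
    simp only [star_trivial, sub_mulVec, dotProduct_sub, smul_mulVec, dotProduct_smul, smul_eq_mul]
    nlinarith

section Frobenius

open scoped Matrix.Norms.Frobenius

/-- If the spectrum of `C` lies in the open unit disc, its powers are square summable. -/
theorem summable_norm_pow_sq {N : ℕ} [NeZero N] (C : Matrix (Fin N) (Fin N) ℝ)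
    (hC : ∀ z ∈ spectrum ℂ (C.map (algebraMap ℝ ℂ)), ‖z‖ < 1) :
    Summable fun k : ℕ => ‖C ^ k‖ ^ 2 := by
  set D := C.map (algebraMap ℝ ℂ) with hD
  have hnorm : ∀ k, ‖D ^ k‖ = ‖C ^ k‖ := fun k => by
    rw [hD, ← RingHom.mapMatrix_apply, ← map_pow, RingHom.mapMatrix_apply]
    exact frobenius_norm_map_eq _ _ fun a => by simp
  have hr : spectralRadius ℂ D < ((1 : NNReal) : ENNReal) :=
    spectrum.spectralRadius_lt_of_forall_lt D fun z hz => by exact_mod_cast hC z hz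
  obtain ⟨r, hr1, hr2⟩ := ENNReal.lt_iff_exists_nnreal_btwn.1 hr
  have hr2' : r < 1 := by exact_mod_cast hr2
  have hlim :=
    (spectrum.pow_nnnorm_pow_one_div_tendsto_nhds_spectralRadius D).eventually_lt_const hr1
  have hb : ∀ᶠ k : ℕ in atTop, ‖C ^ k‖ ≤ r ^ k := by
    filter_upwards [hlim, eventually_gt_atTop 0] with k hk hk0
    have h1 : (‖D ^ k‖₊ : ENNReal) ≤ (r : ENNReal) ^ k := by
      rw [← ENNReal.rpow_natCast, ← ENNReal.rpow_inv_le_iff (by exact_mod_cast hk0)]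
      simpa using hk.le
    have h2 : ‖D ^ k‖₊ ≤ r ^ k := by exact_mod_cast h1
    rw [← hnorm]
    exact_mod_cast h2
  have hgeo : Summable fun k : ℕ => ((r : ℝ) ^ 2) ^ k :=
    summable_geometric_of_lt_one (by positivity)
      (pow_lt_one₀ r.2 (by exact_mod_cast hr2') two_ne_zero)
  refine Summable.of_norm_bounded_eventually_nat hgeo ?_
  filter_upwards [hb] with k hk
  rw [Real.norm_of_nonneg (by positivity), ← pow_mul, mul_comm, pow_mul]
  gcongr

/-- The discrete Lyapunov (Stein) equation is solvable for a Schur stable matrix. -/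
theorem exists_posDef_stein {N : ℕ} [NeZero N] (C Q : Matrix (Fin N) (Fin N) ℝ) (hQ : Q.PosDef)
    (hC : ∀ z ∈ spectrum ℂ (C.map (algebraMap ℝ ℂ)), ‖z‖ < 1) :
    ∃ P : Matrix (Fin N) (Fin N) ℝ, P.PosDef ∧ Cᵀ * P * C + Q = P := by
  set f : ℕ → Matrix (Fin N) (Fin N) ℝ := fun k => (C ^ k)ᵀ * Q * C ^ k with hf
  have hsum : Summable f := by
    refine Summable.of_norm_bounded ((summable_norm_pow_sq C hC).mul_right ‖Q‖) fun k => ?_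
    calc ‖(C ^ k)ᵀ * Q * C ^ k‖ ≤ ‖(C ^ k)ᵀ‖ * ‖Q‖ * ‖C ^ k‖ :=
          (norm_mul_le _ _).trans (by gcongr; exact norm_mul_le _ _)
      _ = ‖C ^ k‖ ^ 2 * ‖Q‖ := by rw [frobenius_norm_transpose]; ring
  have hrec : Cᵀ * (∑' k, f k) * C + Q = ∑' k, f k := by
    rw [← hsum.tsum_mul_left, ← (hsum.mul_left _).tsum_mul_right, hsum.tsum_eq_zero_add, add_comm]
    congr 1
    · simp [hf]
    · refine tsum_congr fun k => ?_
      simp only [hf, pow_succ, transpose_mul, Matrix.mul_assoc]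
  have hfpos : ∀ k, (f k).PosSemidef := fun k => by
    simpa [hf] using hQ.posSemidef.conjTranspose_mul_mul_same (C ^ k)
  have hps : (∑' k, f k).PosSemidef := by
    refine PosSemidef.of_dotProduct_mulVec_nonneg ?_ fun x => ?_
    · rw [IsHermitian, conjTranspose_eq_transpose_of_trivial, transpose_tsum]
      exact tsum_congr fun k => (hfpos k).isHermitian
    · let φ : Matrix (Fin N) (Fin N) ℝ →ₗ[ℝ] ℝ :=
        { toFun := fun L => star x ⬝ᵥ L *ᵥ x
          map_add' := fun L L' => by simp [add_mulVec]
          map_smul' := fun c L => by simp [smul_mulVec] }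
      have h := (hsum.hasSum.map φ φ.continuous_of_finiteDimensional)
      exact h.nonneg fun k => (hfpos k).dotProduct_mulVec_nonneg x
  refine ⟨_, ?_, hrec⟩
  rw [← hrec]
  refine PosDef.posSemidef_add ?_ hQ
  simpa using hps.conjTranspose_mul_mul_same C

end Frobenius

/-- The Lyapunov equation of a Hurwitz matrix is solvable; the proof reduces to the Stein equation
via the Cayley transform `(1 + A) * (1 - A)⁻¹`. -/
theorem exists_posDef_lyapunov {N : ℕ} (A Q : Matrix (Fin N) (Fin N) ℝ) (hQ : Q.PosDef)
    (hA : IsHurwitz A) :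
    ∃ P : Matrix (Fin N) (Fin N) ℝ, P.PosDef ∧ Aᵀ * P + P * A + Q = 0 := by
  rcases Nat.eq_zero_or_pos N with rfl | hN
  · exact ⟨1, PosDef.one, Subsingleton.elim _ _⟩
  have : NeZero N := ⟨hN.ne'⟩
  have hA1 : IsUnit (1 - A).det := by
    rw [isUnit_iff_ne_zero]
    intro h
    have h1 : (1 : ℂ) ∈ spectrum ℂ (A.map (algebraMap ℝ ℂ)) := by
      rw [spectrum.mem_iff, map_one, isUnit_iff_isUnit_det, isUnit_iff_ne_zero, not_not]
      have := congrArg (algebraMap ℝ ℂ) h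
      rw [RingHom.map_det, map_sub, map_one, map_zero] at this
      exact this
    have := hA 1 h1
    norm_num at this
  set E := (1 - A)⁻¹ with hE
  have hE1 : E * (1 - A) = 1 := nonsing_inv_mul _ hA1
  have hE2 : (1 - A) * E = 1 := mul_nonsing_inv _ hA1
  have hEinj : Function.Injective E.mulVec := by
    refine mulVec_injective_of_isUnit ?_
    exact ⟨⟨E, 1 - A, hE1, hE2⟩, rfl⟩
  have hQ' : ((2 : ℝ) • (Eᵀ * Q * E)).PosDef := by
    refine PosDef.smul ?_ two_pos
    simpa using hQ.conjTranspose_mul_mul_same hEinj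
  have hC : ∀ z ∈ spectrum ℂ (((1 + A) * E).map (algebraMap ℝ ℂ)), ‖z‖ < 1 := by
    intro z hz
    obtain ⟨v, hv0, hv⟩ := mem_spectrum_iff_exists_mulVec.1 hz
    set F := E.map (algebraMap ℝ ℂ) with hF
    set G := A.map (algebraMap ℝ ℂ) with hG
    have hCF : ((1 + A) * E).map (algebraMap ℝ ℂ) = (1 + G) * F := by
      simp only [← RingHom.mapMatrix_apply, hF, hG, map_mul, map_add, map_one]
    have hGF : (1 - G) * F = 1 := by
      have := congrArg (algebraMap ℝ ℂ).mapMatrix hE2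
      rwa [map_mul, map_sub, map_one] at this
    set w := F *ᵥ v with hw
    have hvw : v = (1 - G) *ᵥ w := by rw [hw, mulVec_mulVec, hGF, one_mulVec]
    have hw0 : w ≠ 0 := by
      intro h
      rw [h, mulVec_zero] at hvw
      exact hv0 hvw
    rw [hCF, ← mulVec_mulVec, ← hw, hvw, sub_mulVec, add_mulVec, one_mulVec] at hv
    have hcomb : (z + 1) • (G *ᵥ w) = (z - 1) • w := by
      ext i
      have := congrFun hv i
      simp only [Pi.smul_apply, Pi.sub_apply, Pi.add_apply, smul_eq_mul] at this ⊢
      linear_combination this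
    have hz1 : z + 1 ≠ 0 := by
      intro h
      rw [h, zero_smul] at hcomb
      have h2 : z - 1 ≠ 0 := by
        rw [eq_neg_of_add_eq_zero_left h]; norm_num
      exact (smul_ne_zero h2 hw0) hcomb.symm
    have hspec : (z - 1) / (z + 1) ∈ spectrum ℂ G := by
      refine mem_spectrum_iff_exists_mulVec.2 ⟨w, hw0, ?_⟩
      rw [div_eq_inv_mul, mul_smul, ← hcomb, smul_smul, inv_mul_cancel₀ hz1, one_smul]
    have hre := hA _ hspec
    have hns : 0 < Complex.normSq (z + 1) := Complex.normSq_pos.2 hz1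
    rw [Complex.div_re, ← add_div, div_neg_iff] at hre
    have hre' : (z - 1).re * (z + 1).re + (z - 1).im * (z + 1).im < 0 := by
      rcases hre with h | h
      · linarith [h.2]
      · exact h.1
    simp only [Complex.sub_re, Complex.add_re, Complex.one_re, Complex.sub_im, Complex.add_im,
      Complex.one_im] at hre'
    have hsq : ‖z‖ ^ 2 < 1 := by
      rw [← Complex.normSq_eq_norm_sq, Complex.normSq_apply]
      linarith
    nlinarith [norm_nonneg z]
  obtain ⟨P, hP, hPeq⟩ := exists_posDef_stein _ _ hQ' hC
  refine ⟨P, hP, ?_⟩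
  have h := congrArg (fun L => (1 - A)ᵀ * L * (1 - A)) hPeq
  have hE1t : (1 - A)ᵀ * Eᵀ = 1 := by rw [← transpose_mul, hE1, transpose_one]
  have e1 : (1 - A)ᵀ * (((1 + A) * E)ᵀ * P * ((1 + A) * E) + (2 : ℝ) • (Eᵀ * Q * E)) * (1 - A)
      = (1 + A)ᵀ * P * (1 + A) + (2 : ℝ) • Q := by
    calc _ = ((1 - A)ᵀ * Eᵀ) * (1 + A)ᵀ * P * (1 + A) * (E * (1 - A))
          + (2 : ℝ) • (((1 - A)ᵀ * Eᵀ) * Q * (E * (1 - A))) := by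
            rw [transpose_mul]
            simp only [Matrix.mul_add, Matrix.add_mul, Matrix.mul_smul, Matrix.smul_mul,
              Matrix.mul_assoc]
      _ = _ := by rw [hE1, hE1t, Matrix.one_mul, Matrix.one_mul, Matrix.mul_one, Matrix.mul_one]
  rw [e1] at h
  have e2 : (2 : ℝ) • (Aᵀ * P + P * A + Q) = 0 := by
    have : (2 : ℝ) • (Aᵀ * P + P * A + Q)
      = ((1 + A)ᵀ * P * (1 + A) + (2 : ℝ) • Q) - (1 - A)ᵀ * P * (1 - A) := by
      rw [transpose_add, transpose_sub, transpose_one, two_smul, two_smul]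
      noncomm_ring
    rw [this, h, sub_self]
  exact (smul_eq_zero.1 e2).resolve_left two_ne_zero

/-- Range inclusion gives a right factor. -/
theorem exists_mul_eq_of_range_le {p q r : ℕ} {B : Matrix (Fin p) (Fin q) ℝ}
    {D : Matrix (Fin p) (Fin r) ℝ}
    (h : LinearMap.range D.mulVecLin ≤ LinearMap.range B.mulVecLin) :
    ∃ G : Matrix (Fin q) (Fin r) ℝ, B * G = D := by
  have hcol : ∀ j, ∃ g, B *ᵥ g = D.col j := fun j => by
    obtain ⟨g, hg⟩ := h ⟨Pi.single j 1, rfl⟩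
    exact ⟨g, by simpa using hg⟩
  choose g hg using hcol
  refine ⟨(Matrix.of g)ᵀ, ?_⟩
  ext i j
  exact congrFun (hg j) i

/-- when `A` is Hurwitz and `Ran(Ba) ⊆ Ran(Bu)`, the learned
attack gain can be suppressed arbitrarily. -/
theorem stmt15
    (A : Matrix (Fin n) (Fin n) ℝ) (Bu : Matrix (Fin n) (Fin m_u) ℝ)
    (Ba : Matrix (Fin n) (Fin m_a) ℝ)
    (Q : Matrix (Fin n) (Fin n) ℝ) (R : Matrix (Fin m_a) (Fin m_a) ℝ)
    (hQ : Q.PosDef) (hR : R.PosDef)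
    (hA : IsHurwitz A)
    (hRan : LinearMap.range Ba.mulVecLin ≤ LinearMap.range Bu.mulVecLin) :
    ∀ ε : ℝ, 0 < ε → ∃ Λ : Matrix (Fin m_u) (Fin n) ℝ, ∃ P,
      IsStabSol A Bu Ba Q R Λ P ∧ frobNorm (R⁻¹ * Baᵀ * P) < ε := by
  intro ε hε
  obtain ⟨P₀, hP₀, hlyap⟩ := exists_posDef_lyapunov A Q hQ hA
  obtain ⟨G, hG⟩ := exists_mul_eq_of_range_le hRan
  obtain ⟨T, hT⟩ := exists_posDef_smul_sub hQ hP₀.isHermitian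
  have hRi : (R⁻¹)ᵀ = R⁻¹ := hR.inv.isHermitian
  obtain ⟨T₁, hT₁⟩ := exists_posDef_smul_sub (PosDef.one (n := Fin m_a) (R := ℝ))
    hR.inv.isHermitian
  have hRR : (R⁻¹ * R⁻¹).IsHermitian := by
    rw [IsHermitian, conjTranspose_eq_transpose_of_trivial, transpose_mul, hRi]
  obtain ⟨T₂, hT₂⟩ := exists_posDef_smul_sub (PosDef.one (n := Fin m_a) (R := ℝ)) hRR
  obtain ⟨s, hs0, hsT₁, hsT₂⟩ : ∃ s : ℝ, 0 < s ∧ T₁ < s ∧ T₂ < s :=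
    ((eventually_gt_atTop 0).and ((eventually_gt_atTop T₁).and (eventually_gt_atTop T₂))).exists
  obtain ⟨t, ht0, htT, htε⟩ : ∃ t : ℝ, 0 < t ∧ s * T < t ∧ s * P₀.trace / ε ^ 2 < t :=
    ((eventually_gt_atTop 0).and ((eventually_gt_atTop _).and (eventually_gt_atTop _))).exists
  have hP₀u : IsUnit P₀.det := (isUnit_iff_isUnit_det _).1 hP₀.isUnit
  set Y₀ := P₀⁻¹ with hY₀def
  have hPY₀ : P₀ * Y₀ = 1 := mul_nonsing_inv _ hP₀u
  have hYP₀ : Y₀ * P₀ = 1 := nonsing_inv_mul _ hP₀u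
  have hY₀ : Y₀.PosDef := hP₀.inv
  set Y := Y₀ + t • (Ba * Baᵀ) with hYdef
  have hSpos : (Ba * Baᵀ).PosSemidef := by
    simpa using posSemidef_self_mul_conjTranspose Ba
  have hY : Y.PosDef := hY₀.add_posSemidef (hSpos.smul ht0.le)
  have hYu : IsUnit Y.det := (isUnit_iff_isUnit_det _).1 hY.isUnit
  set P := Y⁻¹ with hPdef
  have hPY : P * Y = 1 := nonsing_inv_mul _ hYu
  have hYP : Y * P = 1 := mul_nonsing_inv _ hYu
  have hP : P.PosDef := hY.inv
  have hPt : Pᵀ = P := hP.isHermitian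
  have hP₀t : P₀ᵀ = P₀ := hP₀.isHermitian
  have hQt : Qᵀ = Q := hQ.isHermitian
  have hY₀t : Y₀ᵀ = Y₀ := hY₀.isHermitian
  have hdual : Y₀ * Aᵀ + A * Y₀ + Y₀ * Q * Y₀ = 0 := by
    have h := congrArg (fun L => Y₀ * L * Y₀) hlyap
    simp only [Matrix.mul_add, Matrix.add_mul, Matrix.mul_zero, Matrix.zero_mul] at h
    rw [← h, ← Matrix.mul_assoc Y₀ P₀ A, hYP₀, Matrix.one_mul, Matrix.mul_assoc Y₀ (Aᵀ * P₀),
      Matrix.mul_assoc Aᵀ P₀, hPY₀, Matrix.mul_one]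
  set L := t • (Baᵀ * Aᵀ) + t • (Baᵀ * Q * Y₀) + (t ^ 2 / 2) • (Baᵀ * Q * (Ba * Baᵀ)) with hL
  have hLt : Lᵀ = t • (A * Ba) + t • (Y₀ * Q * Ba) + (t ^ 2 / 2) • (Ba * Baᵀ * Q * Ba) := by
    simp only [hL, transpose_add, transpose_smul, transpose_mul, transpose_transpose, hQt, hY₀t,
      Matrix.mul_assoc]
  have hdualY : Y * Aᵀ + A * Y + Y * Q * Y = Ba * L + Lᵀ * Baᵀ := by
    rw [← sub_eq_zero, ← hdual, hLt, hL, hYdef]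
    simp only [Matrix.mul_add, Matrix.add_mul, Matrix.mul_smul, Matrix.smul_mul, smul_add,
      smul_smul, Matrix.mul_assoc]
    module
  have hPdual : P * (Ba * L + Lᵀ * Baᵀ) * P = Aᵀ * P + P * A + Q := by
    rw [← hdualY]
    calc _ = (P * Y) * Aᵀ * P + P * A * (Y * P) + (P * Y) * Q * (Y * P) := by
          simp only [Matrix.mul_add, Matrix.add_mul, Matrix.mul_assoc]
      _ = _ := by rw [hPY, hYP]; simp only [Matrix.one_mul, Matrix.mul_one]
  set W := Ba * R⁻¹ * Baᵀ with hW
  have hWt : Wᵀ = W := by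
    rw [hW, transpose_mul, transpose_mul, transpose_transpose, hRi, Matrix.mul_assoc]
  set Λ := -(G * (L + (1 / 2 : ℝ) • (R⁻¹ * Baᵀ)) * P) with hΛ
  have hBΛ : Bu * Λ = -(Ba * L * P) - (1 / 2 : ℝ) • (W * P) := by
    rw [hΛ, Matrix.mul_neg, ← Matrix.mul_assoc, ← Matrix.mul_assoc, hG, hW]
    simp only [Matrix.mul_add, Matrix.add_mul, Matrix.mul_smul, Matrix.smul_mul, Matrix.mul_assoc]
    module
  have hBΛt : (Bu * Λ)ᵀ = -(P * Lᵀ * Baᵀ) - (1 / 2 : ℝ) • (P * W) := by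
    rw [hBΛ, transpose_sub, transpose_neg, transpose_smul, transpose_mul, transpose_mul,
      transpose_mul, hWt, hPt, Matrix.mul_assoc]
  have hare : (A + Bu * Λ)ᵀ * P + P * (A + Bu * Λ) + Q + P * W * P = 0 := by
    have h : (A + Bu * Λ)ᵀ * P + P * (A + Bu * Λ) + Q + P * W * P
        = (Aᵀ * P + P * A + Q) - P * (Ba * L + Lᵀ * Baᵀ) * P := by
      rw [transpose_add, hBΛt, hBΛ]
      simp only [Matrix.mul_add, Matrix.add_mul, Matrix.mul_sub, Matrix.sub_mul, Matrix.mul_neg,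
        Matrix.neg_mul, Matrix.mul_smul, Matrix.smul_mul, Matrix.mul_assoc]
      module
    rw [h, hPdual, sub_self]
  have hbound : (P₀ - t • (P * (Ba * Baᵀ) * P)).PosSemidef := by
    have h : P₀ - t • (P * (Ba * Baᵀ) * P)
        = P * (Y₀ + t • (Ba * Baᵀ) + t ^ 2 • ((Ba * Baᵀ) * P₀ * (Ba * Baᵀ))) * P := by
      have h1 : Y * P₀ * Y - t • (Ba * Baᵀ)
          = Y₀ + t • (Ba * Baᵀ) + t ^ 2 • ((Ba * Baᵀ) * P₀ * (Ba * Baᵀ)) := by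
        rw [hYdef, Matrix.add_mul, hYP₀]
        simp only [Matrix.mul_add, Matrix.add_mul, Matrix.mul_smul, Matrix.smul_mul, smul_add,
          smul_smul, Matrix.mul_assoc, hPY₀, Matrix.one_mul, Matrix.mul_one]
        module
      rw [← h1, Matrix.mul_sub, Matrix.sub_mul]
      congr 1
      · calc P₀ = (P * Y) * P₀ * (Y * P) := by rw [hPY, hYP, Matrix.one_mul, Matrix.mul_one]
          _ = _ := by simp only [Matrix.mul_assoc]
      · rw [Matrix.mul_smul, Matrix.smul_mul]
    have h2 : ((Ba * Baᵀ) * P₀ * (Ba * Baᵀ)).PosSemidef := by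
      have := hP₀.posSemidef.conjTranspose_mul_mul_same (Ba * Baᵀ)
      rwa [hSpos.isHermitian] at this
    have h3 := ((hY₀.posSemidef.add (hSpos.smul ht0.le)).add
      (h2.smul (sq_nonneg t))).conjTranspose_mul_mul_same P
    rwa [hP.isHermitian, ← h] at h3
  refine ⟨Λ, P, ⟨hP, ?_, ?_⟩, ?_⟩
  · rw [← hare, hW]
    simp only [Matrix.mul_assoc]
  · refine isHurwitz_of_lyapunov_s15 hP ?_
    have h1 : -((A + Bu * Λ + W * P)ᵀ * P + P * (A + Bu * Λ + W * P)) = Q - P * W * P := by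
      have h : -((A + Bu * Λ + W * P)ᵀ * P + P * (A + Bu * Λ + W * P))
          = -((A + Bu * Λ)ᵀ * P + P * (A + Bu * Λ) + Q + P * W * P) + (Q - P * W * P) := by
        rw [transpose_add _ (W * P), transpose_mul, hPt, hWt]
        simp only [Matrix.mul_add, Matrix.add_mul, Matrix.mul_assoc]
        abel
      rw [h, hare, neg_zero, zero_add]
    have h2 : Q - P * W * P = (s / t) • ((t / s) • Q - P₀)
        + ((s / t) • (P₀ - t • (P * (Ba * Baᵀ) * P))
          + P * (Ba * (s • 1 - R⁻¹) * Baᵀ) * P) := by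
      simp only [hW, Matrix.mul_sub, Matrix.sub_mul, Matrix.mul_smul, Matrix.smul_mul,
        Matrix.mul_one, smul_sub, smul_smul]
      rw [div_mul_div_cancel₀ ht0.ne', div_self hs0.ne', div_mul_cancel₀ _ ht0.ne', one_smul]
      abel
    have h3 : (P * (Ba * (s • 1 - R⁻¹) * Baᵀ) * P).PosSemidef := by
      have := ((hT₁ s hsT₁).posSemidef.mul_mul_conjTranspose_same Ba).mul_mul_conjTranspose_same P
      rwa [hP.isHermitian, conjTranspose_eq_transpose_of_trivial] at this
    rw [h1, h2]
    refine PosDef.add_posSemidef ((hT _ ?_).smul (by positivity))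
      ((hbound.smul (by positivity)).add h3)
    rwa [lt_div_iff₀ hs0, mul_comm]
  · have h1 : (R⁻¹ * Baᵀ * P)ᵀ * (R⁻¹ * Baᵀ * P) = P * (Ba * (R⁻¹ * R⁻¹) * Baᵀ) * P := by
      simp only [transpose_mul, transpose_transpose, hPt, hRi, Matrix.mul_assoc]
    have h2 : (s / t) • P₀ - P * (Ba * (R⁻¹ * R⁻¹) * Baᵀ) * P
        = (s / t) • (P₀ - t • (P * (Ba * Baᵀ) * P))
          + P * (Ba * (s • 1 - R⁻¹ * R⁻¹) * Baᵀ) * P := by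
      simp only [Matrix.mul_sub, Matrix.sub_mul, Matrix.mul_smul, Matrix.smul_mul,
        Matrix.mul_one, smul_sub, smul_smul]
      rw [div_mul_cancel₀ _ ht0.ne']
      abel
    have h3 : (P * (Ba * (s • 1 - R⁻¹ * R⁻¹) * Baᵀ) * P).PosSemidef := by
      have := ((hT₂ s hsT₂).posSemidef.mul_mul_conjTranspose_same Ba).mul_mul_conjTranspose_same P
      rwa [hP.isHermitian, conjTranspose_eq_transpose_of_trivial] at this
    have h4 := ((hbound.smul (show 0 ≤ s / t by positivity)).add h3).trace_nonneg
    rw [← h2, trace_sub, trace_smul, smul_eq_mul, sub_nonneg] at h4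
    rw [frobNorm, h1, Real.sqrt_lt' hε]
    refine h4.trans_lt ?_
    rw [div_lt_iff₀ (by positivity)] at htε
    rw [div_mul_eq_mul_div, div_lt_iff₀ ht0]
    linarith
end
end

section
/- Let Λ ∈ ℝ^{m_u×n}, let Q̂ ∈ ℝ^{n×n} and R̂ ∈ ℝ^{m_a×m_a} be symmetric positive definite with Q̂ ≼ Q and R̂ ≽ R in the Loewner order, and suppose that both the stabilizing solution P_u(Λ) of the ARE with weights (Q, R) and the stabilizing solution P̂_u(Λ) of the ARE with weights (Q̂, R̂) exist. Then P̂_u(Λ) ≼ P_u(Λ) in the Loewner order. -/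
open Matrix Filter Topology

noncomputable section

variable {n m_u m_a : ℕ}

/-- In a complex Banach algebra, the powers of an element whose spectrum lies in the open unit
disc converge to zero. -/
lemma tendsto_pow_zero_of_spectrum_norm_lt_one {E : Type*} [NormedRing E] [NormedAlgebra ℂ E]
    [CompleteSpace E] (a : E) (ha : ∀ z ∈ spectrum ℂ a, ‖z‖ < 1) :
    Tendsto (fun k : ℕ => a ^ k) atTop (𝓝 0) := by
  rcases subsingleton_or_nontrivial E with _ | _
  · exact tendsto_const_nhds.congr fun k => Subsingleton.elim _ _
  have hρ : spectralRadius ℂ a < ((1 : NNReal) : ENNReal) :=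
    spectrum.spectralRadius_lt_of_forall_lt a fun z hz => by
      rw [← NNReal.coe_lt_coe]
      simpa using ha z hz
  obtain ⟨r, har, hr1⟩ := ENNReal.lt_iff_exists_nnreal_btwn.mp hρ
  have hr1' : r < 1 := by exact_mod_cast hr1
  have hev := (spectrum.pow_nnnorm_pow_one_div_tendsto_nhds_spectralRadius a).eventually_lt_const har
  refine squeeze_zero_norm' ?_
    (tendsto_pow_atTop_nhds_zero_of_lt_one r.coe_nonneg (NNReal.coe_lt_one.mpr hr1'))
  filter_upwards [hev, eventually_gt_atTop 0] with k hk hk0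
  have hk0' : (0 : ℝ) < k := by exact_mod_cast hk0
  rw [one_div, ENNReal.rpow_inv_lt_iff hk0', ENNReal.rpow_natCast] at hk
  have hk' : ‖a ^ k‖₊ < r ^ k := by exact_mod_cast hk
  exact_mod_cast hk'.le

/-- If `C * (1 - M) = 1 + M` with `1 - M` invertible and the spectrum of `M` lies in the open
left half-plane, then the spectrum of `C` lies in the open unit disc. -/
lemma norm_lt_one_of_mem_spectrum_cayley {E : Type*} [Ring E] [Algebra ℂ E] {M C : E}
    (hM : ∀ μ ∈ spectrum ℂ M, μ.re < 0) (hN : IsUnit (1 - M)) (hC : C * (1 - M) = 1 + M)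
    {z : ℂ} (hz : z ∈ spectrum ℂ C) : ‖z‖ < 1 := by
  by_contra! hz1
  rw [spectrum.mem_iff] at hz
  obtain ⟨u, hu⟩ := hN
  refine hz ((Units.isUnit_mul_units _ u).mp ?_)
  have hexp : (algebraMap ℂ E z - C) * u = (z - 1) • (1 : E) - (z + 1) • M := by
    rw [hu, sub_mul, hC, Algebra.algebraMap_eq_smul_one, smul_mul_assoc, one_mul, smul_sub,
      sub_smul, add_smul, one_smul, one_smul]
    abel
  rw [hexp]
  by_cases hz0 : z + 1 = 0
  · rw [hz0, zero_smul, sub_zero, ← Algebra.algebraMap_eq_smul_one]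
    refine (IsUnit.mk0 (z - 1) fun h => ?_).map (algebraMap ℂ E)
    exact two_ne_zero (α := ℂ) (by linear_combination hz0 - h)
  · have hμ : (z - 1) / (z + 1) ∉ spectrum ℂ M := fun hmem => by
      refine (hM _ hmem).not_ge ?_
      have hsq : 1 ≤ z.re * z.re + z.im * z.im := by
        rw [← Complex.normSq_apply, Complex.normSq_eq_norm_sq]
        exact one_le_pow₀ hz1
      rw [Complex.div_re, ← add_div]
      refine div_nonneg ?_ (Complex.normSq_nonneg _)
      simp only [Complex.sub_re, Complex.add_re, Complex.sub_im, Complex.add_im, Complex.one_re,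
        Complex.one_im]
      linarith
    rw [spectrum.notMem_iff] at hμ
    have hfac : (z - 1) • (1 : E) - (z + 1) • M
        = algebraMap ℂ E (z + 1) * (algebraMap ℂ E ((z - 1) / (z + 1)) - M) := by
      rw [← Algebra.smul_def, smul_sub, Algebra.algebraMap_eq_smul_one, smul_smul,
        mul_div_cancel₀ _ hz0]
    rw [hfac]
    exact ((IsUnit.mk0 _ hz0).map (algebraMap ℂ E)).mul hμ

/-- If `M` is Hurwitz then the Lyapunov operator of `M` has a positive inverse: a symmetric `X`
with `-(Mᵀ X + X M)` positive semidefinite is itself positive semidefinite. -/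
lemma IsHurwitz.posSemidef_of_lyapunov_s16 {N : ℕ} {M X : Matrix (Fin N) (Fin N) ℝ}
    (hM : IsHurwitz M) (hX : X.IsHermitian) (hW : (-(Mᵀ * X + X * M)).PosSemidef) :
    X.PosSemidef := by
  let φ : Matrix (Fin N) (Fin N) ℝ →+* Matrix (Fin N) (Fin N) ℂ := (algebraMap ℝ ℂ).mapMatrix
  have hM' : ∀ μ ∈ spectrum ℂ (φ M), μ.re < 0 := hM
  have hφN : IsUnit (1 - φ M) := by
    by_contra h
    have h1 : (1 : ℂ) ∈ spectrum ℂ (φ M) := by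
      rw [spectrum.mem_iff]
      simpa using h
    have := hM' 1 h1
    norm_num at this
  have hdet : IsUnit (1 - M).det := by
    have h := (Matrix.isUnit_iff_isUnit_det _).mp hφN
    rw [← map_one φ, ← map_sub, ← RingHom.map_det, isUnit_iff_ne_zero] at h
    exact isUnit_iff_ne_zero.mpr fun h0 => h (by rw [h0, map_zero])
  have hinv : (1 - M) * (1 - M)⁻¹ = 1 := Matrix.mul_nonsing_inv _ hdet
  have hinv' : (1 - M)⁻¹ * (1 - M) = 1 := Matrix.nonsing_inv_mul _ hdet
  set V := (1 - M)⁻¹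
  set C := (1 + M) * V with hC
  have hstep : (X - Cᵀ * X * C).PosSemidef := by
    have key : X - Cᵀ * X * C = Vᵀ * ((2 : ℝ) • (-(Mᵀ * X + X * M))) * V := by
      have h1 : X = Vᵀ * ((1 - M)ᵀ * X * (1 - M)) * V := by
        calc X = ((1 - M) * V)ᵀ * X * ((1 - M) * V) := by rw [hinv]; simp
          _ = _ := by rw [transpose_mul]; simp only [Matrix.mul_assoc]
      have h2 : Cᵀ * X * C = Vᵀ * ((1 + M)ᵀ * X * (1 + M)) * V := by
        rw [hC, transpose_mul]; simp only [Matrix.mul_assoc]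
      have h3 : (1 - M)ᵀ * X * (1 - M) - (1 + M)ᵀ * X * (1 + M)
          = (2 : ℝ) • (-(Mᵀ * X + X * M)) := by
        simp only [transpose_sub, transpose_add, transpose_one, two_smul]
        noncomm_ring
      rw [h2, ← h3]
      nth_rewrite 1 [h1]
      rw [← Matrix.sub_mul, ← Matrix.mul_sub Vᵀ]
    rw [key]
    simpa using (hW.smul (by norm_num : (0 : ℝ) ≤ 2)).conjTranspose_mul_mul_same V
  have hpow : ∀ k : ℕ, (X - (C ^ k)ᵀ * X * C ^ k).PosSemidef := by
    intro k
    induction k with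
    | zero => simpa using Matrix.PosSemidef.zero
    | succ k ih =>
      have h := (ih.conjTranspose_mul_mul_same C).add hstep
      convert h using 1
      rw [pow_succ, transpose_mul, conjTranspose_eq_transpose_of_trivial]
      noncomm_ring
  have hlim : Tendsto (fun k : ℕ => C ^ k) atTop (𝓝 0) := by
    have hφC : φ C * (1 - φ M) = 1 + φ M := by
      rw [← map_one φ, ← map_sub, ← map_mul, ← map_add, hC, Matrix.mul_assoc, hinv',
        Matrix.mul_one]
    have hc : Tendsto (fun k : ℕ => φ C ^ k) atTop (𝓝 0) := by
      let _ := Matrix.linftyOpNormedRing (n := Fin N) (α := ℂ)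
      let _ := Matrix.linftyOpNormedAlgebra (n := Fin N) (R := ℂ) (α := ℂ)
      exact tendsto_pow_zero_of_spectrum_norm_lt_one (φ C) fun z hz =>
        norm_lt_one_of_mem_spectrum_cayley hM' hφN hφC hz
    have hre := ((continuous_id.matrix_map Complex.continuous_re).tendsto
      (0 : Matrix (Fin N) (Fin N) ℂ)).comp hc
    have hfun : (fun k : ℕ => C ^ k) =
        (fun Y : Matrix (Fin N) (Fin N) ℂ => Y.map Complex.re) ∘ fun k => φ C ^ k := by
      funext k
      ext i j
      simp only [Function.comp_apply, ← map_pow]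
      simp [φ]
    rw [hfun]
    simpa using hre
  refine .of_dotProduct_mulVec_nonneg hX fun x => ?_
  have hcont : Continuous fun Y : Matrix (Fin N) (Fin N) ℝ =>
      star x ⬝ᵥ (X - Yᵀ * X * Y) *ᵥ x :=
    continuous_const.dotProduct ((continuous_const.sub
      ((continuous_id.matrix_transpose.matrix_mul continuous_const).matrix_mul
        continuous_id)).matrix_mulVec continuous_const)
  have ht : Tendsto (fun k : ℕ => star x ⬝ᵥ (X - (C ^ k)ᵀ * X * C ^ k) *ᵥ x) atTop
      (𝓝 (star x ⬝ᵥ (X - 0ᵀ * X * 0) *ᵥ x)) := (hcont.tendsto 0).comp hlim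
  rw [Matrix.mul_zero, sub_zero] at ht
  exact ge_of_tendsto' ht fun k => (hpow k).dotProduct_mulVec_nonneg x

/-- Inversion reverses the Loewner order on positive definite matrices. -/
lemma Matrix.PosDef.posSemidef_inv_sub_inv {m : ℕ} {R S : Matrix (Fin m) (Fin m) ℝ}
    (hR : R.PosDef) (hS : S.PosDef) (h : (S - R).PosSemidef) : (R⁻¹ - S⁻¹).PosSemidef := by
  have hRu : R * R⁻¹ = 1 := Matrix.mul_nonsing_inv _ ((Matrix.isUnit_iff_isUnit_det _).mp hR.isUnit)
  have hSu := (Matrix.isUnit_iff_isUnit_det _).mp hS.isUnit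
  have hRu' : R⁻¹ * R = 1 := Matrix.nonsing_inv_mul _ ((Matrix.isUnit_iff_isUnit_det _).mp hR.isUnit)
  have hSS : S * S⁻¹ = 1 := Matrix.mul_nonsing_inv _ hSu
  have hSS' : S⁻¹ * S = 1 := Matrix.nonsing_inv_mul _ hSu
  have hD := h.add (hR.inv.posSemidef.conjTranspose_mul_mul_same (S - R))
  have hE := hD.conjTranspose_mul_mul_same S⁻¹
  convert hE using 1
  rw [hS.inv.isHermitian.eq, h.isHermitian.eq]
  have h1 : S - R + (S - R) * R⁻¹ * (S - R) = S * R⁻¹ * S - S := by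
    have : (S - R) * R⁻¹ * (S - R) = S * R⁻¹ * S - S * (R⁻¹ * R) - (R * R⁻¹) * S
        + (R * R⁻¹) * R := by noncomm_ring
    rw [this, hRu, hRu']
    noncomm_ring
  rw [h1]
  calc R⁻¹ - S⁻¹ = (S⁻¹ * S) * R⁻¹ * (S * S⁻¹) - (S⁻¹ * S) * S⁻¹ := by simp [hSS, hSS']
    _ = _ := by noncomm_ring

/-- monotonicity of stabilizing ARE solutions in the weights:
`Q̂ ≼ Q` and `R̂ ≽ R` imply `P̂_u(Λ) ≼ P_u(Λ)`. -/
theorem stmt16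
    (A : Matrix (Fin n) (Fin n) ℝ) (Bu : Matrix (Fin n) (Fin m_u) ℝ)
    (Ba : Matrix (Fin n) (Fin m_a) ℝ)
    (Q : Matrix (Fin n) (Fin n) ℝ) (R : Matrix (Fin m_a) (Fin m_a) ℝ)
    (hQ : Q.PosDef) (hR : R.PosDef)
    (Qh : Matrix (Fin n) (Fin n) ℝ) (Rh : Matrix (Fin m_a) (Fin m_a) ℝ)
    (hQh : Qh.PosDef) (hRh : Rh.PosDef)
    (hQle : (Q - Qh).PosSemidef) (hRge : (Rh - R).PosSemidef)
    (Λ : Matrix (Fin m_u) (Fin n) ℝ)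
    (P : Matrix (Fin n) (Fin n) ℝ) (hP : IsStabSol A Bu Ba Q R Λ P)
    (Ph : Matrix (Fin n) (Fin n) ℝ) (hPh : IsStabSol A Bu Ba Qh Rh Λ Ph) :
    (P - Ph).PosSemidef := by
  obtain ⟨hPpos, hPeq, -⟩ := hP
  obtain ⟨hPhpos, hPheq, hHur⟩ := hPh
  have hPt : Pᵀ = P := by simpa using hPpos.isHermitian.eq
  have hPht : Phᵀ = Ph := by simpa using hPhpos.isHermitian.eq
  have hRht : Rh⁻¹ᵀ = Rh⁻¹ := by simpa using hRh.inv.isHermitian.eq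
  have hX : (P - Ph).IsHermitian := hPpos.isHermitian.sub hPhpos.isHermitian
  refine hHur.posSemidef_of_lyapunov_s16 hX ?_
  have h1 := (hR.posSemidef_inv_sub_inv hRh hRge).conjTranspose_mul_mul_same (Baᵀ * P)
  have h2 := hRh.inv.posSemidef.conjTranspose_mul_mul_same (Baᵀ * (P - Ph))
  convert (hQle.add h1).add h2 using 1
  simp only [conjTranspose_eq_transpose_of_trivial, transpose_mul, transpose_add, transpose_sub,
    transpose_transpose, hPt, hPht, hRht] at hPeq hPheq ⊢
  rw [← sub_eq_zero, ← neg_eq_zero, ← sub_eq_zero.mpr (hPeq.trans hPheq.symm)]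
  simp only [Matrix.mul_add, Matrix.add_mul, Matrix.mul_sub, Matrix.sub_mul, Matrix.mul_assoc]
  abel
end
end
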